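/- For all x, y ∈ A, the following identities hold in A ⊗ A: x ξ^{1/2} J(Ω_{(1)}) ⊗ Ω_{(2)} = ξ^{1/2} J(Ω_{(1)}) ⊗ Ω_{(2)} x, and J(Ω_{(1)}) ξ^{1/2} y ⊗ Ω_{(2)} = J(Ω_{(1)}) ξ^{1/2} ⊗ y Ω_{(2)}. -/

import Mathlib

open scoped TensorProduct

noncomputable section

/-- An element of a `C*`-algebra is positive iff it is of the form `star y * y`. -/
def IsPosElem {A : Type*} [Mul A] [Star A] (x : A) : Prop := ∃ y : A, x = star y * y

section Helpers

variable {A : Type*} [NormedRing A] [StarRing A] [CStarRing A]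
  [NormedAlgebra ℂ A] [StarModule ℂ A]

/-- Apply a linear functional to the first leg of a tensor (`⟨φ, u₁⟩ u₂`). -/
def lapp (φ : A →ₗ[ℂ] ℂ) : A ⊗[ℂ] A →ₗ[ℂ] A :=
  (TensorProduct.lid ℂ A).toLinearMap ∘ₗ TensorProduct.map φ LinearMap.id

/-- Apply a linear functional to the second leg of a tensor (`⟨φ, u₂⟩ u₁`). -/
def rapp (φ : A →ₗ[ℂ] ℂ) : A ⊗[ℂ] A →ₗ[ℂ] A :=
  (TensorProduct.rid ℂ A).toLinearMap ∘ₗ TensorProduct.map LinearMap.id φ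

/-- Apply a pair of linear functionals to the two legs of a tensor (`⟨φ, u₁⟩⟨ψ, u₂⟩`). -/
def papp (φ ψ : A →ₗ[ℂ] ℂ) : A ⊗[ℂ] A →ₗ[ℂ] ℂ :=
  (TensorProduct.lid ℂ ℂ).toLinearMap ∘ₗ TensorProduct.map φ ψ

end Helpers

/-- A `C*`-weak Hopf algebra: a finite-dimensional unital `C*`-algebra `A` equipped with a
comultiplication `Δ` (written in Sweedler notation `Δ x = x₍₁₎ ⊗ x₍₂₎`), counit `ε` and
antipode `S`, satisfying the axioms of Böhm–Szlachányi.  The field `starT` is the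
(componentwise) star operation on `A ⊗[ℂ] A`, characterized by additivity and its values on
pure tensors. -/
structure WeakHopfData (A : Type*) [NormedRing A] [StarRing A] [CStarRing A]
    [NormedAlgebra ℂ A] [StarModule ℂ A] [FiniteDimensional ℂ A] : Type _ where
  Δ : A →ₗ[ℂ] A ⊗[ℂ] A
  ε : A →ₗ[ℂ] ℂ
  S : A ≃ₗ[ℂ] A
  starT : A ⊗[ℂ] A → A ⊗[ℂ] A
  starT_add : ∀ u v : A ⊗[ℂ] A, starT (u + v) = starT u + starT v
  starT_tmul : ∀ a b : A, starT (a ⊗ₜ[ℂ] b) = star a ⊗ₜ[ℂ] star b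
  /-- coassociativity of the comultiplication -/
  coassoc : (TensorProduct.assoc ℂ A A A).toLinearMap ∘ₗ
      (TensorProduct.map Δ LinearMap.id) ∘ₗ Δ = (TensorProduct.map LinearMap.id Δ) ∘ₗ Δ
  /-- counit axiom, left version -/
  counit_left : (TensorProduct.lid ℂ A).toLinearMap ∘ₗ (TensorProduct.map ε LinearMap.id) ∘ₗ Δ
      = LinearMap.id
  /-- counit axiom, right version -/
  counit_right : (TensorProduct.rid ℂ A).toLinearMap ∘ₗ (TensorProduct.map LinearMap.id ε) ∘ₗ Δ
      = LinearMap.id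
  /-- the comultiplication is multiplicative -/
  Δ_mul : ∀ x y : A, Δ (x * y) = Δ x * Δ y
  /-- the star operation is comultiplicative -/
  Δ_star : ∀ x : A, Δ (star x) = starT (Δ x)
  /-- the unit is weakly comultiplicative:
  `(Δ ⊗ id)(Δ 1) = (Δ 1 ⊗ 1)(1 ⊗ Δ 1)` -/
  Δ_one_weak : (TensorProduct.map Δ LinearMap.id) (Δ 1)
      = (Δ 1 ⊗ₜ[ℂ] (1 : A)) * ((TensorProduct.assoc ℂ A A A).symm ((1 : A) ⊗ₜ[ℂ] Δ 1))
  /-- the unit is weakly comultiplicative: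
  `(Δ ⊗ id)(Δ 1) = (1 ⊗ Δ 1)(Δ 1 ⊗ 1)` -/
  Δ_one_weak' : (TensorProduct.map Δ LinearMap.id) (Δ 1)
      = ((TensorProduct.assoc ℂ A A A).symm ((1 : A) ⊗ₜ[ℂ] Δ 1)) * (Δ 1 ⊗ₜ[ℂ] (1 : A))
  /-- the counit is weakly multiplicative: `ε (x y z) = ε (x y₍₁₎) ε (y₍₂₎ z)` -/
  ε_weak : ∀ x y z : A,
      ε (x * y * z) = papp (ε ∘ₗ LinearMap.mulLeft ℂ x) (ε ∘ₗ LinearMap.mulRight ℂ z) (Δ y)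
  /-- the counit is weakly multiplicative: `ε (x y z) = ε (x y₍₂₎) ε (y₍₁₎ z)` -/
  ε_weak' : ∀ x y z : A,
      ε (x * y * z) = papp (ε ∘ₗ LinearMap.mulRight ℂ z) (ε ∘ₗ LinearMap.mulLeft ℂ x) (Δ y)
  /-- antipode axiom: `x₍₁₎ S(x₍₂₎) = ε (1₍₁₎ x) 1₍₂₎` -/
  antipode_left : ∀ x : A,
      LinearMap.mul' ℂ A ((TensorProduct.map LinearMap.id S.toLinearMap) (Δ x))
        = lapp (ε ∘ₗ LinearMap.mulRight ℂ x) (Δ 1)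
  /-- antipode axiom: `S(x₍₁₎) x₍₂₎ = 1₍₁₎ ε (x 1₍₂₎)` -/
  antipode_right : ∀ x : A,
      LinearMap.mul' ℂ A ((TensorProduct.map S.toLinearMap LinearMap.id) (Δ x))
        = rapp (ε ∘ₗ LinearMap.mulLeft ℂ x) (Δ 1)
  /-- the antipode is antimultiplicative -/
  S_antimul : ∀ x y : A, S (x * y) = S y * S x
  /-- the antipode is anticomultiplicative -/
  S_anticomul : ∀ x : A,
      Δ (S x) = (TensorProduct.comm ℂ A A) ((TensorProduct.map S.toLinearMap S.toLinearMap) (Δ x))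

namespace WeakHopfData

variable {A : Type*} [NormedRing A] [StarRing A] [CStarRing A]
  [NormedAlgebra ℂ A] [StarModule ℂ A] [FiniteDimensional ℂ A]

/-- The source counital map `ε^L (x) = x₍₁₎ S(x₍₂₎)`. -/
def εL (W : WeakHopfData A) : A →ₗ[ℂ] A :=
  LinearMap.mul' ℂ A ∘ₗ TensorProduct.map LinearMap.id W.S.toLinearMap ∘ₗ W.Δ

/-- The target counital map `ε^R (x) = S(x₍₁₎) x₍₂₎`. -/
def εR (W : WeakHopfData A) : A →ₗ[ℂ] A :=
  LinearMap.mul' ℂ A ∘ₗ TensorProduct.map W.S.toLinearMap LinearMap.id ∘ₗ W.Δ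

/-- Full contraction of the iterated coproduct `Δ⁽ⁿ⁾ x = x₍₁₎ ⊗ ⋯ ⊗ x₍ₙ₊₁₎` against a family
of `n+1` linear functionals: `sweedlerEval W n φ x = ⟨φ 0, x₍₁₎⟩ ⋯ ⟨φ n, x₍ₙ₊₁₎⟩`.
Since linear functionals separate the points of a tensor power, identities between iterated
coproducts are faithfully expressed through these contractions. -/
def sweedlerEval (W : WeakHopfData A) : (n : ℕ) → (Fin (n + 1) → (A →ₗ[ℂ] ℂ)) → (A →ₗ[ℂ] ℂ)
  | 0, φ => φ 0
  | n + 1, φ => papp (sweedlerEval W n (Fin.init φ)) (φ (Fin.last (n + 1))) ∘ₗ W.Δ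

end WeakHopfData

/-- A `C*`-weak Hopf algebra together with its canonical distinguished elements:
the Haar integral `h`, the dual Haar integral `hHat`, the square roots `gL`, `gR` of
`E^L h`, `E^R h` (whence the canonical grouplike element `g = gL * gR⁻¹`), real powers
`gLpow`, `gRpow` of `gL` and `gR`, and a positive square root operation `sqrt`;
all characterized by the (uniquely determining) properties listed as fields. -/
structure HaarPkg (A : Type*) [NormedRing A] [StarRing A] [CStarRing A]
    [NormedAlgebra ℂ A] [StarModule ℂ A] [FiniteDimensional ℂ A] : Type _ where
  W : WeakHopfData A
  /-- the Haar integral -/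
  h : A
  haar_left : ∀ x : A, x * h = WeakHopfData.εL W x * h
  haar_right : ∀ x : A, h * x = h * WeakHopfData.εR W x
  haar_counitL : WeakHopfData.εL W h = 1
  haar_counitR : WeakHopfData.εR W h = 1
  haar_idem : h * h = h
  haar_star : star h = h
  haar_S : W.S h = h
  haar_nondeg : ∀ y : A, ∃ φ ψ : A →ₗ[ℂ] ℂ, lapp φ (W.Δ h) = y ∧ rapp ψ (W.Δ h) = y
  /-- the Haar integral of the dual weak Hopf algebra `A*`, as a linear functional on `A` -/
  hHat : A →ₗ[ℂ] ℂ
  hHat_pos : ∀ x : A, ∃ r : ℝ, 0 ≤ r ∧ hHat (star x * x) = (r : ℂ)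
  hHat_S : ∀ x : A, hHat (W.S x) = hHat x
  /-- `gL = (E^L h)^{1/2}` -/
  gL : A
  /-- `gR = (E^R h)^{1/2}` -/
  gR : A
  gL_pos : IsPosElem gL
  gR_pos : IsPosElem gR
  gL_unit : IsUnit gL
  gR_unit : IsUnit gR
  gL_sq : gL * gL = rapp hHat (W.Δ h)
  gR_sq : gR * gR = lapp hHat (W.Δ h)
  gL_mem : gL ∈ Set.range (WeakHopfData.εL W)
  gR_mem : gR ∈ Set.range (WeakHopfData.εR W)
  gR_S : gR = W.S gL
  gLR_comm : gL * gR = gR * gL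
  /-- the canonical grouplike element `g = gL * gR⁻¹` is positive -/
  g_pos : IsPosElem (gL * Ring.inverse gR)
  g_unit : IsUnit (gL * Ring.inverse gR)
  /-- `Δ g = (g ⊗ g) Δ 1` -/
  g_grouplike : W.Δ (gL * Ring.inverse gR)
      = ((gL * Ring.inverse gR) ⊗ₜ[ℂ] (gL * Ring.inverse gR)) * W.Δ 1
  /-- `Δ g = Δ 1 (g ⊗ g)` -/
  g_grouplike' : W.Δ (gL * Ring.inverse gR)
      = W.Δ 1 * ((gL * Ring.inverse gR) ⊗ₜ[ℂ] (gL * Ring.inverse gR))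
  /-- `S g = g⁻¹` -/
  g_S : W.S (gL * Ring.inverse gR) = Ring.inverse (gL * Ring.inverse gR)
  /-- `S² x = g x g⁻¹` -/
  S_sq : ∀ x : A,
      W.S (W.S x) = (gL * Ring.inverse gR) * x * Ring.inverse (gL * Ring.inverse gR)
  /-- `h₍₁₎ ⊗ g h₍₂₎ g = h₍₂₎ ⊗ h₍₁₎` -/
  haar_flip : TensorProduct.map LinearMap.id
      (LinearMap.mulLeft ℂ (gL * Ring.inverse gR) ∘ₗ LinearMap.mulRight ℂ (gL * Ring.inverse gR))
      (W.Δ h) = (TensorProduct.comm ℂ A A) (W.Δ h)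
  /-- dual integral relation `⟨ĥ, x (h gL⁻²)⟩ = ε x` -/
  hHat_dual₁ : ∀ x : A, hHat (x * (h * (Ring.inverse gL * Ring.inverse gL))) = W.ε x
  /-- dual integral relation `⟨ĥ, (gR⁻² h) x⟩ = ε x` -/
  hHat_dual₂ : ∀ x : A, hHat ((Ring.inverse gR * Ring.inverse gR * h) * x) = W.ε x
  /-- dual integral relation `⟨ĥ, (h gL⁻²)₍₂₎⟩ (h gL⁻²)₍₁₎ = 1` -/
  hHat_dual₃ : rapp hHat (W.Δ (h * (Ring.inverse gL * Ring.inverse gL))) = 1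
  /-- dual integral relation `⟨ĥ, (gR⁻² h)₍₁₎⟩ (gR⁻² h)₍₂₎ = 1` -/
  hHat_dual₄ : lapp hHat (W.Δ (Ring.inverse gR * Ring.inverse gR * h)) = 1
  /-- the positive square root, via the continuous functional calculus -/
  sqrt : A → A
  sqrt_pos : ∀ x : A, IsPosElem x → IsPosElem (sqrt x)
  sqrt_mul_self : ∀ x : A, IsPosElem x → sqrt x * sqrt x = x
  /-- real powers of `gL`, via the continuous functional calculus -/
  gLpow : ℝ → A
  /-- real powers of `gR`, via the continuous functional calculus -/
  gRpow : ℝ → A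
  gLpow_one : gLpow 1 = gL
  gRpow_one : gRpow 1 = gR
  gLpow_zero : gLpow 0 = 1
  gRpow_zero : gRpow 0 = 1
  gLpow_add : ∀ s t : ℝ, gLpow (s + t) = gLpow s * gLpow t
  gRpow_add : ∀ s t : ℝ, gRpow (s + t) = gRpow s * gRpow t
  gLpow_pos : ∀ t : ℝ, IsPosElem (gLpow t)
  gRpow_pos : ∀ t : ℝ, IsPosElem (gRpow t)
  gLpow_continuous : Continuous gLpow
  gRpow_continuous : Continuous gRpow

namespace HaarPkg

variable {A : Type*} [NormedRing A] [StarRing A] [CStarRing A]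
  [NormedAlgebra ℂ A] [StarModule ℂ A] [FiniteDimensional ℂ A]
variable (P : HaarPkg A)

/-- The canonical grouplike element `g = gL gR⁻¹`. -/
def g : A := P.gL * Ring.inverse P.gR

/-- The Watatani index `ı = ε^L (h gL⁻²)` of the Haar conditional expectations. -/
def iotaEl : A := WeakHopfData.εL P.W (P.h * (Ring.inverse P.gL * Ring.inverse P.gL))

/-- The element `ȷ = ⟨ĥ, (gL⁻²)₍₁₎⟩ (gL⁻²)₍₂₎`, the dual analogue of the Watatani index. -/
def jayEl : A := lapp P.hHat (P.W.Δ (Ring.inverse P.gL * Ring.inverse P.gL))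

/-- The pulling-through element `Ω = ı⁻¹ gL⁻¹ h gL⁻¹`. -/
def Ω : A := Ring.inverse P.iotaEl * Ring.inverse P.gL * P.h * Ring.inverse P.gL

/-- The map `J x = g^{-1/2} S(x) g^{1/2}`, as a linear map. -/
def Jlin : A →ₗ[ℂ] A :=
  LinearMap.mulRight ℂ (P.sqrt P.g) ∘ₗ
    LinearMap.mulLeft ℂ (Ring.inverse (P.sqrt P.g)) ∘ₗ P.W.S.toLinearMap

/-- The functional `⟨ω, x⟩ = ⟨ĥ, ȷ⁻¹ gL⁻¹ gR⁻¹ x⟩` (the dual analogue of `Ω`). -/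
def ω : A →ₗ[ℂ] ℂ :=
  P.hHat ∘ₗ LinearMap.mulLeft ℂ (Ring.inverse P.jayEl * (Ring.inverse P.gL * Ring.inverse P.gR))

/-- `ξ_L = ı^{1/2} ȷ^{1/2} gL`. -/
def ξL : A := P.sqrt P.iotaEl * P.sqrt P.jayEl * P.gL

/-- `ξ_R = ı^{1/2} ȷ^{1/2} gR`. -/
def ξR : A := P.sqrt P.iotaEl * P.sqrt P.jayEl * P.gR

/-- `ξ = ξ_L ξ_R`. -/
def ξ : A := P.ξL * P.ξR

/-- `J^L x = gL⁻¹ S(x) gL`. -/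
def JL : A → A := fun x => Ring.inverse P.gL * P.W.S x * P.gL

/-- `J^R x = gL S⁻¹(x) gL⁻¹`. -/
def JR : A → A := fun x => P.gL * P.W.S.symm x * Ring.inverse P.gL

end HaarPkg

set_option linter.unusedSectionVars false
section Positive

variable {A : Type*}

lemma IsPosElem.star_eq [Mul A] [StarMul A] {x : A} (hx : IsPosElem x) : star x = x := by
  obtain ⟨y, rfl⟩ := hx
  simp

lemma IsPosElem.star_mul_mul [Semigroup A] [StarMul A] {x : A} (hx : IsPosElem x) (a : A) :
    IsPosElem (star a * x * a) := by
  obtain ⟨y, rfl⟩ := hx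
  exact ⟨y * a, by simp [mul_assoc]⟩

lemma IsPosElem.mul_mul [Semigroup A] [StarMul A] {x a : A} (hx : IsPosElem x)
    (ha : star a = a) : IsPosElem (a * x * a) := by
  simpa [ha] using hx.star_mul_mul a

lemma IsPosElem.star_inverse [Ring A] [StarRing A] {x : A} (hx : IsPosElem x) :
    star (Ring.inverse x) = Ring.inverse x := by
  by_cases h : IsUnit x
  · obtain ⟨u, rfl⟩ := h
    have hu : star u = u := Units.ext (by simpa using hx.star_eq)
    rw [Ring.inverse_unit, ← Units.coe_star, star_inv, hu]
  · simp [Ring.inverse_non_unit _ h]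

lemma IsPosElem.inverse [Ring A] [StarRing A] {x : A} (hx : IsPosElem x) :
    IsPosElem (Ring.inverse x) := by
  by_cases h : IsUnit x
  · have := hx.mul_mul hx.star_inverse
    rwa [Ring.inverse_mul_cancel _ h, one_mul] at this
  · exact ⟨0, by simp [Ring.inverse_non_unit _ h]⟩

lemma isPosElem_iff_nonneg [CStarAlgebra A] [PartialOrder A] [StarOrderedRing A] {x : A} :
    IsPosElem x ↔ 0 ≤ x :=
  CStarAlgebra.nonneg_iff_eq_star_mul_self.symm

variable [NormedRing A] [StarRing A] [CStarRing A]
  [NormedAlgebra ℂ A] [StarModule ℂ A] [FiniteDimensional ℂ A]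

variable (A) in
/-- A finite-dimensional normed `*`-algebra with the `C*`-identity is a `C*`-algebra. -/
abbrev cstarAlgebraOfFiniteDimensional : CStarAlgebra A where
  toCompleteSpace := FiniteDimensional.complete ℂ A

lemma IsPosElem.eq_of_mul_self_eq {s t : A} (hs : IsPosElem s) (ht : IsPosElem t)
    (h : s * s = t * t) : s = t := by
  let _ := cstarAlgebraOfFiniteDimensional A
  let _ := CStarAlgebra.spectralOrder A
  have := CStarAlgebra.spectralOrderedRing A
  exact (CFC.mul_self_eq_mul_self_iff s t (isPosElem_iff_nonneg.1 hs)
    (isPosElem_iff_nonneg.1 ht)).1 h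

lemma IsPosElem.commute_of_commute_mul_self {s b : A} (hs : IsPosElem s)
    (h : Commute (s * s) b) : Commute s b := by
  let _ := cstarAlgebraOfFiniteDimensional A
  let _ := CStarAlgebra.spectralOrder A
  have := CStarAlgebra.spectralOrderedRing A
  rw [← CFC.sqrt_mul_self s (isPosElem_iff_nonneg.1 hs)]
  exact h.cfcₙ_nnreal _

lemma IsPosElem.mul_of_commute {s t : A} (hs : IsPosElem s) (ht : IsPosElem t)
    (h : Commute s t) : IsPosElem (s * t) := by
  let _ := cstarAlgebraOfFiniteDimensional A
  let _ := CStarAlgebra.spectralOrder A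
  have := CStarAlgebra.spectralOrderedRing A
  exact isPosElem_iff_nonneg.2 (h.mul_nonneg (isPosElem_iff_nonneg.1 hs)
    (isPosElem_iff_nonneg.1 ht))

lemma isPosElem_sum {ι : Type*} (s : Finset ι) {f : ι → A} (h : ∀ i ∈ s, IsPosElem (f i)) :
    IsPosElem (∑ i ∈ s, f i) := by
  let _ := cstarAlgebraOfFiniteDimensional A
  let _ := CStarAlgebra.spectralOrder A
  have := CStarAlgebra.spectralOrderedRing A
  exact isPosElem_iff_nonneg.2 (Finset.sum_nonneg fun i hi => isPosElem_iff_nonneg.1 (h i hi))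

lemma map_star_of_pos {φ : A →ₗ[ℂ] ℂ} (hφ : ∀ x, ∃ r : ℝ, 0 ≤ r ∧ φ (star x * x) = r) (x : A) :
    φ (star x) = star (φ x) := by
  obtain ⟨r₀, -, h₀⟩ := hφ x
  obtain ⟨r₁, -, h₁⟩ := hφ 1
  obtain ⟨r₂, -, h₂⟩ := hφ (1 + x)
  obtain ⟨r₃, -, h₃⟩ := hφ (1 + Complex.I • x)
  simp only [star_add, star_one, star_smul, add_mul, mul_add, one_mul, mul_one, map_add,
    smul_mul_assoc, mul_smul_comm, map_smul, h₀, smul_eq_mul] at h₁ h₂ h₃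
  rw [h₁] at h₂ h₃
  apply_fun Complex.im at h₂ h₃
  simp at h₂ h₃
  apply Complex.ext <;> simp <;> linarith

open scoped ComplexOrder in
/-- Slicing a positive tensor with a positive functional gives a positive element. -/
lemma isPosElem_gram {φ : A →ₗ[ℂ] ℂ} (hφ : ∀ x, ∃ r : ℝ, 0 ≤ r ∧ φ (star x * x) = r)
    {ι : Type*} [Fintype ι] (a b : ι → A) :
    IsPosElem (∑ i, ∑ j, φ (star (b i) * b j) • (star (a i) * a j)) := by
  let M : Matrix ι ι ℂ := Matrix.of fun i j => φ (star (b i) * b j)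
  have hM : M.PosSemidef := by
    rw [Matrix.posSemidef_iff_dotProduct_mulVec]
    refine ⟨?_, fun x => ?_⟩
    · ext i j
      simp only [M, Matrix.conjTranspose_apply, Matrix.of_apply]
      rw [← map_star_of_pos hφ]
      simp
    · obtain ⟨r, hr, h⟩ := hφ (∑ i, x i • b i)
      have : star x ⬝ᵥ (M.mulVec x) = r := by
        rw [← h]
        simp only [dotProduct, Matrix.mulVec, M, Matrix.of_apply, star_sum, Finset.sum_mul,
          Finset.mul_sum, map_sum, star_smul, smul_mul_assoc, mul_smul_comm, map_smul,
          smul_eq_mul, Pi.star_apply]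
        rw [Finset.sum_comm]
        refine Finset.sum_congr rfl fun i _ => Finset.sum_congr rfl fun j _ => ?_
        ring
      rw [this]
      exact_mod_cast hr
  obtain ⟨m, v, hv⟩ := Matrix.posSemidef_iff_eq_sum_vecMulVec.1 hM
  have h₁ : ∀ i j, φ (star (b i) * b j) = ∑ k, v k i * star (v k j) := by
    intro i j
    have := congrFun (congrFun hv i) j
    simpa [M, Matrix.sum_apply, Matrix.vecMulVec_apply] using this
  have h₂ : ∑ i, ∑ j, φ (star (b i) * b j) • (star (a i) * a j)
      = ∑ k, star (∑ i, star (v k i) • a i) * ∑ j, star (v k j) • a j := by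
    simp only [h₁, star_sum, star_smul, star_star, Finset.sum_mul_sum, smul_mul_smul_comm,
      Finset.sum_smul]
    refine (Finset.sum_congr rfl fun i _ => Finset.sum_comm).trans ?_
    rw [Finset.sum_comm]
  rw [h₂]
  exact isPosElem_sum _ fun k _ => ⟨_, rfl⟩

end Positive

section TensorLemmas

variable {A : Type*} [NormedRing A] [StarRing A] [CStarRing A]
  [NormedAlgebra ℂ A] [StarModule ℂ A]

@[simp] lemma lapp_tmul (φ : A →ₗ[ℂ] ℂ) (a b : A) : lapp φ (a ⊗ₜ[ℂ] b) = φ a • b := by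
  simp [lapp]

@[simp] lemma rapp_tmul (φ : A →ₗ[ℂ] ℂ) (a b : A) : rapp φ (a ⊗ₜ[ℂ] b) = φ b • a := by
  simp [rapp]

lemma lapp_inr_mul (φ : A →ₗ[ℂ] ℂ) (a : A) (u : A ⊗[ℂ] A) :
    lapp φ ((1 : A) ⊗ₜ[ℂ] a * u) = a * lapp φ u := by
  induction u with
  | zero => simp
  | tmul p q => simp
  | add u v hu hv => simp only [mul_add, map_add, hu, hv]

lemma rapp_inl_mul (φ : A →ₗ[ℂ] ℂ) (a : A) (u : A ⊗[ℂ] A) :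
    rapp φ (a ⊗ₜ[ℂ] (1 : A) * u) = a * rapp φ u := by
  induction u with
  | zero => simp
  | tmul p q => simp
  | add u v hu hv => simp only [mul_add, map_add, hu, hv]

lemma lapp_mul_inr (φ : A →ₗ[ℂ] ℂ) (a : A) (u : A ⊗[ℂ] A) :
    lapp φ (u * (1 : A) ⊗ₜ[ℂ] a) = lapp φ u * a := by
  induction u with
  | zero => simp
  | tmul p q => simp
  | add u v hu hv => simp only [add_mul, map_add, hu, hv]

lemma rapp_mul_inl (φ : A →ₗ[ℂ] ℂ) (a : A) (u : A ⊗[ℂ] A) :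
    rapp φ (u * a ⊗ₜ[ℂ] (1 : A)) = rapp φ u * a := by
  induction u with
  | zero => simp
  | tmul p q => simp
  | add u v hu hv => simp only [add_mul, map_add, hu, hv]

end TensorLemmas

section TensorAlgebra

variable {A : Type*} [Semiring A] [Algebra ℂ A]

lemma inl_mul_inr_comm (a b : A) :
    a ⊗ₜ[ℂ] (1 : A) * (1 : A) ⊗ₜ[ℂ] b = (1 : A) ⊗ₜ[ℂ] b * a ⊗ₜ[ℂ] (1 : A) := by
  simp

lemma inl_mul_inl (a b : A) :
    a ⊗ₜ[ℂ] (1 : A) * b ⊗ₜ[ℂ] (1 : A) = (a * b) ⊗ₜ[ℂ] (1 : A) := by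
  simp

lemma inr_mul_inr (a b : A) :
    (1 : A) ⊗ₜ[ℂ] a * (1 : A) ⊗ₜ[ℂ] b = (1 : A) ⊗ₜ[ℂ] (a * b) := by
  simp

end TensorAlgebra

namespace WeakHopfData

variable {A : Type*} [NormedRing A] [StarRing A] [CStarRing A]
  [NormedAlgebra ℂ A] [StarModule ℂ A] [FiniteDimensional ℂ A] (W : WeakHopfData A)

lemma Δ_one_mul (x : A) : W.Δ 1 * W.Δ x = W.Δ x := by rw [← W.Δ_mul, one_mul]

lemma Δ_mul_one (x : A) : W.Δ x * W.Δ 1 = W.Δ x := by rw [← W.Δ_mul, mul_one]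

@[simp] lemma lapp_ε_Δ (x : A) : lapp W.ε (W.Δ x) = x :=
  LinearMap.congr_fun W.counit_left x

@[simp] lemma rapp_ε_Δ (x : A) : rapp W.ε (W.Δ x) = x :=
  LinearMap.congr_fun W.counit_right x

/-- Coassociativity, tested against a linear map on the triple tensor product. -/
lemma coassoc_apply {V : Type*} [AddCommMonoid V] [Module ℂ V]
    (F : (A ⊗[ℂ] A) ⊗[ℂ] A →ₗ[ℂ] V) (x : A) :
    F (TensorProduct.map W.Δ LinearMap.id (W.Δ x))
      = F ((TensorProduct.assoc ℂ A A A).symm (TensorProduct.map LinearMap.id W.Δ (W.Δ x))) := by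
  congr 1
  rw [LinearEquiv.eq_symm_apply]
  exact LinearMap.congr_fun W.coassoc x

lemma εL_eq (x : A) : W.εL x = lapp (W.ε ∘ₗ LinearMap.mulRight ℂ x) (W.Δ 1) := W.antipode_left x

lemma εR_eq (x : A) : W.εR x = rapp (W.ε ∘ₗ LinearMap.mulLeft ℂ x) (W.Δ 1) := W.antipode_right x

lemma εL_one : W.εL 1 = 1 := by
  rw [εL_eq, show W.ε ∘ₗ LinearMap.mulRight ℂ 1 = W.ε by ext; simp, lapp_ε_Δ]

lemma εR_one : W.εR 1 = 1 := by
  rw [εR_eq, show W.ε ∘ₗ LinearMap.mulLeft ℂ 1 = W.ε by ext; simp, rapp_ε_Δ]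

/-- The slice `φ ⊗ id ⊗ id` of a triple tensor. -/
def slice₁ (φ : A →ₗ[ℂ] ℂ) : (A ⊗[ℂ] A) ⊗[ℂ] A →ₗ[ℂ] A ⊗[ℂ] A :=
  TensorProduct.map (lapp φ) LinearMap.id

/-- The slice `id ⊗ id ⊗ φ` of a triple tensor. -/
def slice₃ (φ : A →ₗ[ℂ] ℂ) : (A ⊗[ℂ] A) ⊗[ℂ] A →ₗ[ℂ] A ⊗[ℂ] A :=
  (TensorProduct.rid ℂ (A ⊗[ℂ] A)).toLinearMap ∘ₗ TensorProduct.map LinearMap.id φ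

lemma slice₁_map_id_Δ (φ : A →ₗ[ℂ] ℂ) (u : A ⊗[ℂ] A) :
    slice₁ φ ((TensorProduct.assoc ℂ A A A).symm (TensorProduct.map LinearMap.id W.Δ u))
      = W.Δ (lapp φ u) := by
  induction u with
  | zero => simp
  | add u v hu hv => simp only [map_add, hu, hv]
  | tmul a b =>
    simp only [TensorProduct.map_tmul, LinearMap.id_apply, lapp_tmul, map_smul]
    induction W.Δ b with
    | zero => simp
    | tmul p q => simp [slice₁, TensorProduct.smul_tmul']
    | add u v hu hv => simp only [TensorProduct.tmul_add, map_add, hu, hv, smul_add]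

lemma slice₃_map_Δ_id (φ : A →ₗ[ℂ] ℂ) (u : A ⊗[ℂ] A) :
    slice₃ φ (TensorProduct.map W.Δ LinearMap.id u) = W.Δ (rapp φ u) := by
  induction u with
  | zero => simp
  | add u v hu hv => simp only [map_add, hu, hv]
  | tmul a b => simp [slice₃]

lemma slice₁_mul (φ : A →ₗ[ℂ] ℂ) (u v : A ⊗[ℂ] A) :
    slice₁ φ (u ⊗ₜ[ℂ] (1 : A) * (TensorProduct.assoc ℂ A A A).symm ((1 : A) ⊗ₜ[ℂ] v))
      = lapp φ u ⊗ₜ[ℂ] (1 : A) * v := by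
  induction v with
  | zero => simp
  | add v w hv hw => simp only [TensorProduct.tmul_add, map_add, mul_add, hv, hw]
  | tmul a b => simp [slice₁, lapp_mul_inr]

lemma slice₁_mul' (φ : A →ₗ[ℂ] ℂ) (u v : A ⊗[ℂ] A) :
    slice₁ φ ((TensorProduct.assoc ℂ A A A).symm ((1 : A) ⊗ₜ[ℂ] v) * u ⊗ₜ[ℂ] (1 : A))
      = v * lapp φ u ⊗ₜ[ℂ] (1 : A) := by
  induction v with
  | zero => simp
  | add v w hv hw => simp only [TensorProduct.tmul_add, map_add, add_mul, hv, hw]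
  | tmul a b => simp [slice₁, lapp_inr_mul]

lemma slice₃_mul (φ : A →ₗ[ℂ] ℂ) (u v : A ⊗[ℂ] A) :
    slice₃ φ (u ⊗ₜ[ℂ] (1 : A) * (TensorProduct.assoc ℂ A A A).symm ((1 : A) ⊗ₜ[ℂ] v))
      = u * (1 : A) ⊗ₜ[ℂ] rapp φ v := by
  induction v with
  | zero => simp
  | add v w hv hw => simp only [TensorProduct.tmul_add, map_add, mul_add, hv, hw]
  | tmul a b => simp [slice₃]

lemma slice₃_mul' (φ : A →ₗ[ℂ] ℂ) (u v : A ⊗[ℂ] A) :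
    slice₃ φ ((TensorProduct.assoc ℂ A A A).symm ((1 : A) ⊗ₜ[ℂ] v) * u ⊗ₜ[ℂ] (1 : A))
      = (1 : A) ⊗ₜ[ℂ] rapp φ v * u := by
  induction v with
  | zero => simp
  | add v w hv hw => simp only [TensorProduct.tmul_add, map_add, add_mul, hv, hw]
  | tmul a b => simp [slice₃]

lemma Δ_lapp_one (φ : A →ₗ[ℂ] ℂ) :
    W.Δ (lapp φ (W.Δ 1)) = lapp φ (W.Δ 1) ⊗ₜ[ℂ] (1 : A) * W.Δ 1 := by
  rw [← slice₁_map_id_Δ, ← coassoc_apply, W.Δ_one_weak, slice₁_mul]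

lemma Δ_lapp_one' (φ : A →ₗ[ℂ] ℂ) :
    W.Δ (lapp φ (W.Δ 1)) = W.Δ 1 * lapp φ (W.Δ 1) ⊗ₜ[ℂ] (1 : A) := by
  rw [← slice₁_map_id_Δ, ← coassoc_apply, W.Δ_one_weak', slice₁_mul']

lemma Δ_rapp_one (φ : A →ₗ[ℂ] ℂ) :
    W.Δ (rapp φ (W.Δ 1)) = (1 : A) ⊗ₜ[ℂ] rapp φ (W.Δ 1) * W.Δ 1 := by
  rw [← slice₃_map_Δ_id, W.Δ_one_weak', slice₃_mul']

lemma Δ_rapp_one' (φ : A →ₗ[ℂ] ℂ) :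
    W.Δ (rapp φ (W.Δ 1)) = W.Δ 1 * (1 : A) ⊗ₜ[ℂ] rapp φ (W.Δ 1) := by
  rw [← slice₃_map_Δ_id, W.Δ_one_weak, slice₃_mul]

lemma lapp_slice (w v : A ⊗[ℂ] A) (p q : A) :
    TensorProduct.map LinearMap.id (lapp W.ε ∘ₗ LinearMap.mulLeft ℂ w)
      (TensorProduct.assoc ℂ A A A ((TensorProduct.assoc ℂ A A A).symm ((1 : A) ⊗ₜ[ℂ] v)
        * (p ⊗ₜ[ℂ] q) ⊗ₜ[ℂ] (1 : A)))
      = p ⊗ₜ[ℂ] lapp W.ε (w * (v * q ⊗ₜ[ℂ] (1 : A))) := by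
  induction v with
  | zero => simp
  | add v v' hv hw => simp only [TensorProduct.tmul_add, map_add, add_mul, hv, hw, mul_add]
  | tmul a b => simp

lemma rapp_slice (w u : A ⊗[ℂ] A) (p q : A) :
    TensorProduct.map (rapp W.ε ∘ₗ LinearMap.mulRight ℂ w) LinearMap.id
      ((TensorProduct.assoc ℂ A A A).symm ((1 : A) ⊗ₜ[ℂ] (p ⊗ₜ[ℂ] q)) * u ⊗ₜ[ℂ] (1 : A))
      = rapp W.ε (((1 : A) ⊗ₜ[ℂ] p * u) * w) ⊗ₜ[ℂ] q := by
  simp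

/-- `ε^R(x₍₁₎) ⊗ x₍₂₎ = 1₍₁₎ ⊗ x 1₍₂₎`. -/
lemma map_εR_id_Δ (x : A) :
    TensorProduct.map W.εR LinearMap.id (W.Δ x) = (1 : A) ⊗ₜ[ℂ] x * W.Δ 1 := by
  obtain ⟨s, hs⟩ := TensorProduct.exists_finset (W.Δ 1)
  have h₁ : ∀ w : A ⊗[ℂ] A, TensorProduct.map W.εR LinearMap.id w
      = ∑ i ∈ s, i.1 ⊗ₜ[ℂ] lapp W.ε (w * i.2 ⊗ₜ[ℂ] (1 : A)) := by
    intro w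
    induction w with
    | zero => simp
    | add v w hv hw =>
      simp only [map_add, add_mul, hv, hw, TensorProduct.tmul_add, Finset.sum_add_distrib]
    | tmul a b =>
      simp [εR_eq, hs, TensorProduct.sum_tmul, TensorProduct.smul_tmul]
  have h₂ := W.coassoc_apply (TensorProduct.map LinearMap.id
    (lapp W.ε ∘ₗ LinearMap.mulLeft ℂ (W.Δ x)) ∘ₗ (TensorProduct.assoc ℂ A A A).toLinearMap) 1
  have h₃ : ∀ u : A ⊗[ℂ] A, TensorProduct.map LinearMap.id
      (lapp W.ε ∘ₗ LinearMap.mulLeft ℂ (W.Δ x)) (TensorProduct.map LinearMap.id W.Δ u)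
      = (1 : A) ⊗ₜ[ℂ] x * u := by
    intro u
    induction u with
    | zero => simp
    | add v w hv hw => simp only [map_add, mul_add, hv, hw]
    | tmul a b => simp [← W.Δ_mul]
  simp only [LinearMap.comp_apply, LinearEquiv.coe_coe, LinearEquiv.apply_symm_apply, h₃,
    W.Δ_one_weak'] at h₂
  rw [h₁, ← h₂]
  conv_rhs => rw [show W.Δ 1 ⊗ₜ[ℂ] (1 : A) = ∑ i ∈ s, (i.1 ⊗ₜ[ℂ] i.2) ⊗ₜ[ℂ] (1 : A) by
    rw [hs, TensorProduct.sum_tmul]]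
  simp only [Finset.mul_sum, map_sum, lapp_slice]
  simp only [← mul_assoc, W.Δ_mul_one]

/-- `x₍₁₎ ⊗ ε^L(x₍₂₎) = 1₍₁₎ x ⊗ 1₍₂₎`. -/
lemma map_id_εL_Δ (x : A) :
    TensorProduct.map LinearMap.id W.εL (W.Δ x) = W.Δ 1 * x ⊗ₜ[ℂ] (1 : A) := by
  obtain ⟨s, hs⟩ := TensorProduct.exists_finset (W.Δ 1)
  have h₁ : ∀ w : A ⊗[ℂ] A, TensorProduct.map LinearMap.id W.εL w
      = ∑ i ∈ s, rapp W.ε ((1 : A) ⊗ₜ[ℂ] i.1 * w) ⊗ₜ[ℂ] i.2 := by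
    intro w
    induction w with
    | zero => simp
    | add v w hv hw =>
      simp only [map_add, mul_add, hv, hw, TensorProduct.add_tmul, Finset.sum_add_distrib]
    | tmul a b =>
      simp [εL_eq, hs, TensorProduct.tmul_sum, TensorProduct.smul_tmul]
  have h₂ := W.coassoc_apply (TensorProduct.map
    (rapp W.ε ∘ₗ LinearMap.mulRight ℂ (W.Δ x)) LinearMap.id) 1
  have h₃ : ∀ u : A ⊗[ℂ] A, TensorProduct.map
      (rapp W.ε ∘ₗ LinearMap.mulRight ℂ (W.Δ x)) LinearMap.id
        (TensorProduct.map W.Δ LinearMap.id u) = u * x ⊗ₜ[ℂ] (1 : A) := by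
    intro u
    induction u with
    | zero => simp
    | add v w hv hw => simp only [map_add, add_mul, hv, hw]
    | tmul a b => simp [← W.Δ_mul]
  rw [← h₂, W.Δ_one_weak'] at h₂
  rw [← h₃, h₁, W.Δ_one_weak']
  conv_rhs => rw [show (1 : A) ⊗ₜ[ℂ] W.Δ 1 = ∑ i ∈ s, (1 : A) ⊗ₜ[ℂ] (i.1 ⊗ₜ[ℂ] i.2) by
    rw [hs, TensorProduct.tmul_sum]]
  simp only [Finset.sum_mul, map_sum, rapp_slice]
  simp only [mul_assoc, W.Δ_one_mul]

/-- `S(x₍₁₎) ε^L(x₍₂₎) = S(x)`. -/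
lemma mul_map_S_εL (x : A) :
    LinearMap.mul' ℂ A (TensorProduct.map W.S.toLinearMap W.εL (W.Δ x)) = W.S x := by
  have h₁ : ∀ u : A ⊗[ℂ] A, LinearMap.mul' ℂ A (TensorProduct.map W.S.toLinearMap LinearMap.id
      (u * x ⊗ₜ[ℂ] (1 : A)))
      = W.S x * LinearMap.mul' ℂ A (TensorProduct.map W.S.toLinearMap LinearMap.id u) := by
    intro u
    induction u with
    | zero => simp
    | add v w hv hw => simp only [map_add, mul_add, add_mul, hv, hw]
    | tmul a b => simp [W.S_antimul, mul_assoc]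
  have h₂ : TensorProduct.map W.S.toLinearMap W.εL (W.Δ x)
      = TensorProduct.map W.S.toLinearMap LinearMap.id
        (TensorProduct.map LinearMap.id W.εL (W.Δ x)) := by
    rw [TensorProduct.map_map]; simp
  have h₃ : LinearMap.mul' ℂ A (TensorProduct.map W.S.toLinearMap LinearMap.id (W.Δ 1)) = 1 :=
    W.εR_one
  rw [h₂, map_id_εL_Δ, h₁, h₃, mul_one]

/-- `ε^R(x₍₁₎) S(x₍₂₎) = S(x)`. -/
lemma mul_map_εR_S (x : A) :
    LinearMap.mul' ℂ A (TensorProduct.map W.εR W.S.toLinearMap (W.Δ x)) = W.S x := by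
  have h₁ : ∀ u : A ⊗[ℂ] A, LinearMap.mul' ℂ A (TensorProduct.map LinearMap.id W.S.toLinearMap
      ((1 : A) ⊗ₜ[ℂ] x * u))
      = LinearMap.mul' ℂ A (TensorProduct.map LinearMap.id W.S.toLinearMap u) * W.S x := by
    intro u
    induction u with
    | zero => simp
    | add v w hv hw => simp only [map_add, mul_add, add_mul, hv, hw]
    | tmul a b => simp [W.S_antimul, mul_assoc]
  have h₂ : TensorProduct.map W.εR W.S.toLinearMap (W.Δ x)
      = TensorProduct.map LinearMap.id W.S.toLinearMap
        (TensorProduct.map W.εR LinearMap.id (W.Δ x)) := by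
    rw [TensorProduct.map_map]; simp
  have h₃ : LinearMap.mul' ℂ A (TensorProduct.map LinearMap.id W.S.toLinearMap (W.Δ 1)) = 1 :=
    W.εL_one
  rw [h₂, map_εR_id_Δ, h₁, h₃, one_mul]

/-- `S(x₍₁₎) x₍₂₎ ⊗ x₍₃₎`, bracketed in two ways and multiplied into a third tensor. -/
lemma map_εR_id_Δ_mul (x : A) (H : A ⊗[ℂ] A) :
    TensorProduct.map W.εR LinearMap.id (W.Δ x) * H
      = LinearMap.mul' ℂ (A ⊗[ℂ] A) (TensorProduct.map
          ((TensorProduct.mk ℂ A A).flip 1 ∘ₗ W.S.toLinearMap)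
          (LinearMap.mulRight ℂ H ∘ₗ W.Δ) (W.Δ x)) := by
  have h := W.coassoc_apply (LinearMap.mulRight ℂ H ∘ₗ TensorProduct.map (LinearMap.mul' ℂ A ∘ₗ
    TensorProduct.map W.S.toLinearMap LinearMap.id) LinearMap.id) x
  have h₁ : ∀ u : A ⊗[ℂ] A, TensorProduct.map (LinearMap.mul' ℂ A ∘ₗ
      TensorProduct.map W.S.toLinearMap LinearMap.id) LinearMap.id
        (TensorProduct.map W.Δ LinearMap.id u) = TensorProduct.map W.εR LinearMap.id u := by
    intro u
    rw [TensorProduct.map_map]; rfl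
  have h₂ : ∀ (a : A) (v : A ⊗[ℂ] A), TensorProduct.map (LinearMap.mul' ℂ A ∘ₗ
      TensorProduct.map W.S.toLinearMap LinearMap.id) LinearMap.id
        ((TensorProduct.assoc ℂ A A A).symm (a ⊗ₜ[ℂ] v)) = W.S a ⊗ₜ[ℂ] (1 : A) * v := by
    intro a v
    induction v with
    | zero => simp
    | add v w hv hw => simp only [TensorProduct.tmul_add, map_add, mul_add, hv, hw]
    | tmul p q => simp
  simp only [LinearMap.comp_apply, h₁, LinearMap.mulRight_apply] at h
  rw [h]
  induction W.Δ x with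
  | zero => simp
  | add v w hv hw => simp only [map_add, add_mul, hv, hw]
  | tmul p q =>
    simp only [TensorProduct.map_tmul, LinearMap.id_apply, h₂]
    simp [mul_assoc]

/-- `x₍₁₎ ⊗ x₍₂₎ S(x₍₃₎)`, bracketed in two ways and multiplied into a third tensor. -/
lemma mul_map_id_εL_Δ (x : A) (H : A ⊗[ℂ] A) :
    H * TensorProduct.map LinearMap.id W.εL (W.Δ x)
      = LinearMap.mul' ℂ (A ⊗[ℂ] A) (TensorProduct.map
          (LinearMap.mulLeft ℂ H ∘ₗ W.Δ)
          (TensorProduct.mk ℂ A A 1 ∘ₗ W.S.toLinearMap) (W.Δ x)) := by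
  have h := W.coassoc_apply (LinearMap.mulLeft ℂ H ∘ₗ TensorProduct.map LinearMap.id
    (LinearMap.mul' ℂ A ∘ₗ TensorProduct.map LinearMap.id W.S.toLinearMap) ∘ₗ
      (TensorProduct.assoc ℂ A A A).toLinearMap) x
  have h₁ : ∀ u : A ⊗[ℂ] A, TensorProduct.map LinearMap.id (LinearMap.mul' ℂ A ∘ₗ
      TensorProduct.map LinearMap.id W.S.toLinearMap)
        (TensorProduct.map LinearMap.id W.Δ u) = TensorProduct.map LinearMap.id W.εL u := by
    intro u
    rw [TensorProduct.map_map]; rfl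
  have h₂ : ∀ (a : A) (v : A ⊗[ℂ] A), TensorProduct.map LinearMap.id (LinearMap.mul' ℂ A ∘ₗ
      TensorProduct.map LinearMap.id W.S.toLinearMap)
        (TensorProduct.assoc ℂ A A A (v ⊗ₜ[ℂ] a)) = v * (1 : A) ⊗ₜ[ℂ] W.S a := by
    intro a v
    induction v with
    | zero => simp
    | add v w hv hw => simp only [TensorProduct.add_tmul, map_add, add_mul, hv, hw]
    | tmul p q => simp
  simp only [LinearMap.comp_apply, LinearEquiv.coe_coe, LinearEquiv.apply_symm_apply, h₁,
    LinearMap.mulLeft_apply] at h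
  rw [← h]
  induction W.Δ x with
  | zero => simp
  | add v w hv hw => simp only [map_add, mul_add, hv, hw]
  | tmul p q =>
    simp only [TensorProduct.map_tmul, LinearMap.id_apply, h₂]
    simp [mul_assoc]

/-- `ε^L(1₍₁₎) ⊗ 1₍₂₎ = S(1₍₁₎) ⊗ 1₍₂₎`. -/
lemma map_εL_id_Δ_one :
    TensorProduct.map W.εL LinearMap.id (W.Δ 1)
      = TensorProduct.map W.S.toLinearMap LinearMap.id (W.Δ 1) := by
  have h₁ : TensorProduct.map W.εL LinearMap.id (W.Δ 1)
      = TensorProduct.map (LinearMap.mul' ℂ A ∘ₗ TensorProduct.map LinearMap.id W.S.toLinearMap)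
        LinearMap.id (TensorProduct.map W.Δ LinearMap.id (W.Δ 1)) := by
    rw [TensorProduct.map_map]; rfl
  have h₂ : ∀ (a : A) (u : A ⊗[ℂ] A), LinearMap.mul' ℂ A (TensorProduct.map LinearMap.id
      W.S.toLinearMap ((1 : A) ⊗ₜ[ℂ] a * u))
      = LinearMap.mul' ℂ A (TensorProduct.map LinearMap.id W.S.toLinearMap u) * W.S a := by
    intro a u
    induction u with
    | zero => simp
    | add v w hv hw => simp only [map_add, mul_add, add_mul, hv, hw]
    | tmul p q => simp [W.S_antimul, mul_assoc]
  have h₃ : LinearMap.mul' ℂ A (TensorProduct.map LinearMap.id W.S.toLinearMap (W.Δ 1)) = 1 :=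
    W.εL_one
  have h₄ : ∀ v : A ⊗[ℂ] A, TensorProduct.map (LinearMap.mul' ℂ A ∘ₗ
      TensorProduct.map LinearMap.id W.S.toLinearMap) LinearMap.id
        ((TensorProduct.assoc ℂ A A A).symm ((1 : A) ⊗ₜ[ℂ] v) * W.Δ 1 ⊗ₜ[ℂ] (1 : A))
      = TensorProduct.map W.S.toLinearMap LinearMap.id v := by
    intro v
    induction v with
    | zero => simp
    | add v w hv hw => simp only [map_add, TensorProduct.tmul_add, add_mul, hv, hw]
    | tmul p q => simp [h₂, h₃]
  rw [h₁, W.Δ_one_weak', h₄]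

/-- `a` multiplies coproducts through their first leg, as do the elements of `A^L`. -/
def MemL (a : A) : Prop :=
  W.Δ a = a ⊗ₜ[ℂ] (1 : A) * W.Δ 1 ∧ W.Δ a = W.Δ 1 * a ⊗ₜ[ℂ] (1 : A)

/-- `a` multiplies coproducts through their second leg, as do the elements of `A^R`. -/
def MemR (a : A) : Prop :=
  W.Δ a = (1 : A) ⊗ₜ[ℂ] a * W.Δ 1 ∧ W.Δ a = W.Δ 1 * (1 : A) ⊗ₜ[ℂ] a

variable {W}

lemma MemL.Δ_mul_left {a : A} (ha : W.MemL a) (x : A) :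
    W.Δ (a * x) = a ⊗ₜ[ℂ] (1 : A) * W.Δ x := by
  rw [W.Δ_mul, ha.1, mul_assoc, Δ_one_mul]

lemma MemL.Δ_mul_right {a : A} (ha : W.MemL a) (x : A) :
    W.Δ (x * a) = W.Δ x * a ⊗ₜ[ℂ] (1 : A) := by
  rw [W.Δ_mul, ha.2, ← mul_assoc, Δ_mul_one]

lemma MemR.Δ_mul_left {a : A} (ha : W.MemR a) (x : A) :
    W.Δ (a * x) = (1 : A) ⊗ₜ[ℂ] a * W.Δ x := by
  rw [W.Δ_mul, ha.1, mul_assoc, Δ_one_mul]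

lemma MemR.Δ_mul_right {a : A} (ha : W.MemR a) (x : A) :
    W.Δ (x * a) = W.Δ x * (1 : A) ⊗ₜ[ℂ] a := by
  rw [W.Δ_mul, ha.2, ← mul_assoc, Δ_mul_one]

lemma MemL.mul {a b : A} (ha : W.MemL a) (hb : W.MemL b) : W.MemL (a * b) := by
  constructor
  · rw [ha.Δ_mul_left, hb.1, ← mul_assoc, inl_mul_inl]
  · rw [hb.Δ_mul_right, ha.2, mul_assoc, inl_mul_inl]

lemma MemR.mul {a b : A} (ha : W.MemR a) (hb : W.MemR b) : W.MemR (a * b) := by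
  constructor
  · rw [ha.Δ_mul_left, hb.1, ← mul_assoc, inr_mul_inr]
  · rw [hb.Δ_mul_right, ha.2, mul_assoc, inr_mul_inr]

lemma MemL.inverse {a b : A} (ha : W.MemL a) (hab : a * b = 1) (hba : b * a = 1) :
    W.MemL b := by
  have h₁ : (b ⊗ₜ[ℂ] (1 : A)) * (a ⊗ₜ[ℂ] (1 : A)) = 1 := by
    rw [inl_mul_inl, hba, Algebra.TensorProduct.one_def]
  have h₂ : (a ⊗ₜ[ℂ] (1 : A)) * (b ⊗ₜ[ℂ] (1 : A)) = 1 := by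
    rw [inl_mul_inl, hab, Algebra.TensorProduct.one_def]
  constructor
  · rw [show W.Δ 1 = W.Δ (a * b) by rw [hab], ha.Δ_mul_left, ← mul_assoc, h₁, one_mul]
  · rw [show W.Δ 1 = W.Δ (b * a) by rw [hba], ha.Δ_mul_right, mul_assoc, h₂, mul_one]

lemma MemR.inverse {a b : A} (ha : W.MemR a) (hab : a * b = 1) (hba : b * a = 1) :
    W.MemR b := by
  have h₁ : ((1 : A) ⊗ₜ[ℂ] b) * ((1 : A) ⊗ₜ[ℂ] a) = 1 := by
    rw [inr_mul_inr, hba, Algebra.TensorProduct.one_def]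
  have h₂ : ((1 : A) ⊗ₜ[ℂ] a) * ((1 : A) ⊗ₜ[ℂ] b) = 1 := by
    rw [inr_mul_inr, hab, Algebra.TensorProduct.one_def]
  constructor
  · rw [show W.Δ 1 = W.Δ (a * b) by rw [hab], ha.Δ_mul_left, ← mul_assoc, h₁, one_mul]
  · rw [show W.Δ 1 = W.Δ (b * a) by rw [hba], ha.Δ_mul_right, mul_assoc, h₂, mul_one]

variable (W)

lemma memL_εL (x : A) : W.MemL (W.εL x) := by
  rw [εL_eq]; exact ⟨W.Δ_lapp_one _, W.Δ_lapp_one' _⟩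

lemma memR_rapp (φ : A →ₗ[ℂ] ℂ) : W.MemR (rapp φ (W.Δ 1)) :=
  ⟨W.Δ_rapp_one _, W.Δ_rapp_one' _⟩

lemma memR_εR (x : A) : W.MemR (W.εR x) := by
  rw [εR_eq]; exact W.memR_rapp _

lemma S_one : W.S 1 = 1 := by
  obtain ⟨y, hy⟩ := W.S.surjective 1
  simpa [hy] using (W.S_antimul y 1).symm

/-- Elements `h` with `x h = ε^L(x) h` satisfy `S(x) h₍₁₎ ⊗ h₍₂₎ = h₍₁₎ ⊗ x h₍₂₎`. -/
lemma inl_S_mul_Δ {h : A} (hh : ∀ x, x * h = W.εL x * h) (x : A) :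
    W.S x ⊗ₜ[ℂ] (1 : A) * W.Δ h = (1 : A) ⊗ₜ[ℂ] x * W.Δ h := by
  have h₁ := W.map_εR_id_Δ_mul x (W.Δ h)
  have h₂ : ∀ u : A ⊗[ℂ] A, LinearMap.mul' ℂ (A ⊗[ℂ] A) (TensorProduct.map
      ((TensorProduct.mk ℂ A A).flip 1 ∘ₗ W.S.toLinearMap)
      (LinearMap.mulRight ℂ (W.Δ h) ∘ₗ W.Δ) u)
      = LinearMap.mul' ℂ A (TensorProduct.map W.S.toLinearMap W.εL u) ⊗ₜ[ℂ] (1 : A) * W.Δ h := by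
    intro u
    induction u with
    | zero => simp
    | add v w hv hw => simp only [map_add, TensorProduct.add_tmul, add_mul, hv, hw]
    | tmul a b =>
      simp only [TensorProduct.map_tmul, LinearMap.comp_apply, LinearMap.mulRight_apply,
        ← W.Δ_mul, hh b, (W.memL_εL b).Δ_mul_left, LinearMap.mul'_apply, LinearEquiv.coe_coe,
        LinearMap.flip_apply, TensorProduct.mk_apply, ← mul_assoc, inl_mul_inl]
  rw [map_εR_id_Δ, mul_assoc, Δ_one_mul, h₂, mul_map_S_εL] at h₁
  exact h₁.symm

/-- Elements `h` with `h x = h ε^R(x)` satisfy `h₍₁₎ x ⊗ h₍₂₎ = h₍₁₎ ⊗ h₍₂₎ S(x)`. -/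
lemma Δ_mul_inl {h : A} (hh : ∀ x, h * x = h * W.εR x) (x : A) :
    W.Δ h * x ⊗ₜ[ℂ] (1 : A) = W.Δ h * (1 : A) ⊗ₜ[ℂ] W.S x := by
  have h₁ := W.mul_map_id_εL_Δ x (W.Δ h)
  have h₂ : ∀ u : A ⊗[ℂ] A, LinearMap.mul' ℂ (A ⊗[ℂ] A) (TensorProduct.map
      (LinearMap.mulLeft ℂ (W.Δ h) ∘ₗ W.Δ)
      (TensorProduct.mk ℂ A A 1 ∘ₗ W.S.toLinearMap) u)
      = W.Δ h * (1 : A) ⊗ₜ[ℂ] LinearMap.mul' ℂ A (TensorProduct.map W.εR W.S.toLinearMap u) := by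
    intro u
    induction u with
    | zero => simp
    | add v w hv hw => simp only [map_add, TensorProduct.tmul_add, mul_add, hv, hw]
    | tmul a b =>
      simp only [TensorProduct.map_tmul, LinearMap.comp_apply, LinearMap.mulLeft_apply,
        ← W.Δ_mul, hh a, (W.memR_εR a).Δ_mul_right, LinearMap.mul'_apply, LinearEquiv.coe_coe,
        TensorProduct.mk_apply, mul_assoc, inr_mul_inr]
  rwa [map_id_εL_Δ, ← mul_assoc, Δ_mul_one, h₂, mul_map_εR_S] at h₁

end WeakHopfData

namespace HaarPkg

variable {A : Type*} [NormedRing A] [StarRing A] [CStarRing A]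
  [NormedAlgebra ℂ A] [StarModule ℂ A] [FiniteDimensional ℂ A] (P : HaarPkg A)

lemma inl_S_mul_Δ_h (x : A) :
    P.W.S x ⊗ₜ[ℂ] (1 : A) * P.W.Δ P.h = (1 : A) ⊗ₜ[ℂ] x * P.W.Δ P.h :=
  P.W.inl_S_mul_Δ P.haar_left x

lemma Δ_h_mul_inl (x : A) :
    P.W.Δ P.h * x ⊗ₜ[ℂ] (1 : A) = P.W.Δ P.h * (1 : A) ⊗ₜ[ℂ] P.W.S x :=
  P.W.Δ_mul_inl P.haar_right x

lemma gL_mul_inv : P.gL * Ring.inverse P.gL = 1 := Ring.mul_inverse_cancel _ P.gL_unit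
lemma gL_inv_mul : Ring.inverse P.gL * P.gL = 1 := Ring.inverse_mul_cancel _ P.gL_unit
lemma gR_mul_inv : P.gR * Ring.inverse P.gR = 1 := Ring.mul_inverse_cancel _ P.gR_unit
lemma gR_inv_mul : Ring.inverse P.gR * P.gR = 1 := Ring.inverse_mul_cancel _ P.gR_unit

lemma memL_gL : P.W.MemL P.gL := by
  obtain ⟨x, hx⟩ := P.gL_mem
  rw [← hx]; exact P.W.memL_εL x

lemma memR_gR : P.W.MemR P.gR := by
  obtain ⟨x, hx⟩ := P.gR_mem
  rw [← hx]; exact P.W.memR_εR x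

lemma memL_gL_inv : P.W.MemL (Ring.inverse P.gL) :=
  P.memL_gL.inverse P.gL_mul_inv P.gL_inv_mul

lemma memR_gR_inv : P.W.MemR (Ring.inverse P.gR) :=
  P.memR_gR.inverse P.gR_mul_inv P.gR_inv_mul

lemma commute_ringInverse {M : Type*} [MonoidWithZero M] {a b : M} (h : Commute a b)
    (hb : IsUnit b) : Commute a (Ring.inverse b) := by
  obtain ⟨u, rfl⟩ := hb
  rw [Ring.inverse_unit]
  exact h.units_inv_right

lemma commute_gL_gR : Commute P.gL P.gR := P.gLR_comm

lemma S_gL : P.W.S P.gL = P.gR := P.gR_S.symm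

lemma S_gL_inv : P.W.S (Ring.inverse P.gL) = Ring.inverse P.gR := by
  have h₁ : P.W.S (Ring.inverse P.gL) * P.gR = 1 := by
    rw [P.gR_S, ← P.W.S_antimul, P.gL_mul_inv, P.W.S_one]
  rw [← mul_one (P.W.S _), ← P.gR_mul_inv, ← mul_assoc, h₁, one_mul]

lemma S_gR : P.W.S P.gR = P.gL := by
  have h : Commute (P.gL * Ring.inverse P.gR) P.gL :=
    (Commute.refl _).mul_left (commute_ringInverse P.commute_gL_gR P.gR_unit).symm
  rw [P.gR_S, P.S_sq, h.eq, mul_assoc, Ring.mul_inverse_cancel _ P.g_unit, mul_one]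

lemma S_gR_inv : P.W.S (Ring.inverse P.gR) = Ring.inverse P.gL := by
  have h₁ : P.W.S (Ring.inverse P.gR) * P.gL = 1 := by
    rw [← P.S_gR, ← P.W.S_antimul, P.gR_mul_inv, P.W.S_one]
  rw [← mul_one (P.W.S _), ← P.gL_mul_inv, ← mul_assoc, h₁, one_mul]

/-- `ı` is central. -/
lemma commute_iotaEl (y : A) : Commute y P.iotaEl := by
  obtain ⟨x, rfl⟩ := P.W.S.surjective y
  set a := Ring.inverse P.gL * Ring.inverse P.gL with ha
  have h₀ : P.iotaEl = LinearMap.mul' ℂ A (TensorProduct.map LinearMap.id P.W.S.toLinearMap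
      (P.W.Δ P.h * a ⊗ₜ[ℂ] (1 : A))) := by
    rw [← (P.memL_gL_inv.mul P.memL_gL_inv).Δ_mul_right]; rfl
  have h₁ : ∀ u : A ⊗[ℂ] A, P.W.S x * LinearMap.mul' ℂ A (TensorProduct.map LinearMap.id
      P.W.S.toLinearMap u) = LinearMap.mul' ℂ A (TensorProduct.map LinearMap.id
      P.W.S.toLinearMap (P.W.S x ⊗ₜ[ℂ] (1 : A) * u)) := by
    intro u
    induction u with
    | zero => simp
    | add v w hv hw => simp only [map_add, mul_add, hv, hw]
    | tmul p q => simp [mul_assoc]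
  have h₂ : ∀ u : A ⊗[ℂ] A, LinearMap.mul' ℂ A (TensorProduct.map LinearMap.id
      P.W.S.toLinearMap u) * P.W.S x = LinearMap.mul' ℂ A (TensorProduct.map LinearMap.id
      P.W.S.toLinearMap ((1 : A) ⊗ₜ[ℂ] x * u)) := by
    intro u
    induction u with
    | zero => simp
    | add v w hv hw => simp only [map_add, mul_add, add_mul, hv, hw]
    | tmul p q => simp [mul_assoc, P.W.S_antimul]
  rw [commute_iff_eq, h₀, h₁, h₂, ← mul_assoc, ← mul_assoc, inl_S_mul_Δ_h]

lemma S_eq_rapp_hHat (x : A) :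
    P.W.S x = rapp P.hHat ((1 : A) ⊗ₜ[ℂ] x
      * P.W.Δ (P.h * (Ring.inverse P.gL * Ring.inverse P.gL))) := by
  have h := P.hHat_dual₃
  rw [(P.memL_gL_inv.mul P.memL_gL_inv).Δ_mul_right] at h ⊢
  rw [← mul_assoc, ← inl_S_mul_Δ_h, mul_assoc, rapp_inl_mul, h, mul_one]

lemma S_eq_lapp_hHat (x : A) :
    P.W.S x = lapp P.hHat (P.W.Δ (Ring.inverse P.gR * Ring.inverse P.gR * P.h)
      * x ⊗ₜ[ℂ] (1 : A)) := by
  have h := P.hHat_dual₄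
  rw [(P.memR_gR_inv.mul P.memR_gR_inv).Δ_mul_left] at h ⊢
  rw [mul_assoc, Δ_h_mul_inl, ← mul_assoc, lapp_mul_inr, h, one_mul]

/-- `h₍₁₎ ⟨ĥ, x h₍₂₎⟩ = S(x) gL²`. -/
lemma rapp_hHat_Δ_h (x : A) :
    rapp P.hHat ((1 : A) ⊗ₜ[ℂ] x * P.W.Δ P.h) = P.W.S x * (P.gL * P.gL) := by
  rw [S_eq_rapp_hHat, ← rapp_mul_inl, mul_assoc, ← (P.memL_gL.mul P.memL_gL).Δ_mul_right]
  congr 3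
  rw [mul_assoc, mul_assoc, ← mul_assoc _ P.gL P.gL, gL_inv_mul, one_mul, gL_inv_mul, mul_one]

/-- `⟨ĥ, h₍₁₎ x⟩ h₍₂₎ = gR² S(x)`. -/
lemma lapp_hHat_Δ_h (x : A) :
    lapp P.hHat (P.W.Δ P.h * x ⊗ₜ[ℂ] (1 : A)) = P.gR * P.gR * P.W.S x := by
  rw [S_eq_lapp_hHat, ← lapp_inr_mul, ← mul_assoc, ← (P.memR_gR.mul P.memR_gR).Δ_mul_left]
  congr 3
  rw [← mul_assoc, ← mul_assoc, mul_assoc P.gR, gR_mul_inv, mul_one, gR_mul_inv, one_mul]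

lemma functional_ext {f f' : A →ₗ[ℂ] ℂ} (h : rapp f (P.W.Δ P.h) = rapp f' (P.W.Δ P.h)) :
    f = f' := by
  have key : ∀ (f φ : A →ₗ[ℂ] ℂ) (u : A ⊗[ℂ] A), f (lapp φ u) = φ (rapp f u) := by
    intro f φ u
    induction u with
    | zero => simp
    | add v w hv hw => simp only [map_add, hv, hw]
    | tmul p q => simp [mul_comm]
  ext b
  obtain ⟨φ, -, hφ, -⟩ := P.haar_nondeg b
  rw [← hφ, key, key, h]

/-- The modular property of `ĥ`, untwisted form. -/
lemma hHat_g_mul (w x : A) :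
    P.hHat (P.g * w * P.g * x)
      = P.hHat (Ring.inverse P.gR * Ring.inverse P.gR * x * (P.gL * P.gL) * w) := by
  have hl : ∀ (φ : A →ₗ[ℂ] ℂ) (u : A ⊗[ℂ] A),
      lapp φ (u * x ⊗ₜ[ℂ] (1 : A))
        = rapp (φ ∘ₗ LinearMap.mulRight ℂ x) (TensorProduct.comm ℂ A A u) := by
    intro φ u
    induction u with
    | zero => simp
    | add v w hv hw => simp only [map_add, add_mul, hv, hw]
    | tmul p q => simp
  have hr : ∀ (φ : A →ₗ[ℂ] ℂ) (y : A) (u : A ⊗[ℂ] A),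
      rapp φ ((1 : A) ⊗ₜ[ℂ] y * u) = rapp (φ ∘ₗ LinearMap.mulLeft ℂ y) u := by
    intro φ y u
    induction u with
    | zero => simp
    | add v w hv hw => simp only [map_add, mul_add, hv, hw]
    | tmul p q => simp
  have hc : ∀ (φ : A →ₗ[ℂ] ℂ) (f : A →ₗ[ℂ] A) (u : A ⊗[ℂ] A),
      rapp φ (TensorProduct.map LinearMap.id f u) = rapp (φ ∘ₗ f) u := by
    intro φ f u
    induction u with
    | zero => simp
    | add v w hv hw => simp only [map_add, hv, hw]
    | tmul p q => simp
  have h₁ := P.lapp_hHat_Δ_h x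
  rw [hl, ← P.haar_flip, hc] at h₁
  have h₂ := P.rapp_hHat_Δ_h (Ring.inverse P.gR * Ring.inverse P.gR * x * (P.gL * P.gL))
  have h₃ : P.W.S (Ring.inverse P.gR * Ring.inverse P.gR * x * (P.gL * P.gL)) * (P.gL * P.gL)
      = P.gR * P.gR * P.W.S x := by
    simp only [P.W.S_antimul, S_gL, S_gR_inv]
    have e : Ring.inverse P.gL * Ring.inverse P.gL * (P.gL * P.gL) = 1 := by
      rw [mul_assoc, ← mul_assoc _ P.gL P.gL, gL_inv_mul, one_mul, gL_inv_mul]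
    rw [mul_assoc, mul_assoc, mul_assoc (P.W.S x), e, mul_one, mul_assoc]
  rw [h₃, hr, ← h₁] at h₂
  have h₄ := LinearMap.congr_fun (P.functional_ext h₂) w
  simp only [LinearMap.comp_apply, LinearMap.mulLeft_apply, LinearMap.mulRight_apply] at h₄
  rw [h₄, HaarPkg.g]
  simp only [mul_assoc]

lemma g_eq : P.g = P.gL * Ring.inverse P.gR := rfl

lemma g_mul_inv : P.g * Ring.inverse P.g = 1 := Ring.mul_inverse_cancel _ P.g_unit

lemma g_inv_mul : Ring.inverse P.g * P.g = 1 := Ring.inverse_mul_cancel _ P.g_unit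

lemma commute_gL_gR_inv : Commute P.gL (Ring.inverse P.gR) :=
  commute_ringInverse P.commute_gL_gR P.gR_unit

lemma S_mul_g (x : A) : P.W.S x * P.g = P.g * P.W.S.symm x := by
  have h := P.S_sq (P.W.S.symm x)
  rw [LinearEquiv.apply_symm_apply, ← g_eq] at h
  rw [h, mul_assoc, g_inv_mul, mul_one]

/-- `⟨ĥ, gR⁻² p S(q)⟩ = ⟨ĥ, S(p) q gL⁻²⟩`. -/
lemma hHat_swap (p q : A) :
    P.hHat (Ring.inverse P.gR * Ring.inverse P.gR * (p * P.W.S q))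
      = P.hHat (P.W.S p * q * (Ring.inverse P.gL * Ring.inverse P.gL)) := by
  have e : Commute P.gL (Ring.inverse P.gR) := P.commute_gL_gR_inv
  have h := P.hHat_g_mul (Ring.inverse P.g * (Ring.inverse P.gR * Ring.inverse P.gR * p))
    (Ring.inverse P.g * P.W.S q)
  have h₁ : P.g * (Ring.inverse P.g * (Ring.inverse P.gR * Ring.inverse P.gR * p)) * P.g
      * (Ring.inverse P.g * P.W.S q) = Ring.inverse P.gR * Ring.inverse P.gR * (p * P.W.S q) := by
    rw [← mul_assoc P.g, g_mul_inv, one_mul, mul_assoc, ← mul_assoc P.g, g_mul_inv, one_mul,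
      mul_assoc _ p]
  have h₂ : Ring.inverse P.g * P.W.S q = P.W.S.symm q * Ring.inverse P.g := by
    have := P.S_mul_g q
    calc _ = Ring.inverse P.g * (P.W.S q * P.g) * Ring.inverse P.g := by
          rw [mul_assoc, mul_assoc, g_mul_inv, mul_one]
      _ = _ := by rw [this, ← mul_assoc _ P.g, g_inv_mul, one_mul]
  have h₃ : P.gL * P.gL * (Ring.inverse P.gR * Ring.inverse P.gR) = P.g * P.g := by
    rw [g_eq, mul_assoc, mul_assoc, ← mul_assoc P.gL (Ring.inverse P.gR), e.eq]
    simp only [mul_assoc, e.eq]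
  have h₄ : Ring.inverse P.g * (P.gL * P.gL * (Ring.inverse P.g
      * (Ring.inverse P.gR * Ring.inverse P.gR * p))) = p := by
    have hLg : Commute P.gL (Ring.inverse P.g) :=
      commute_ringInverse ((Commute.refl _).mul_right e) P.g_unit
    rw [← mul_assoc (P.gL * P.gL), (hLg.mul_left hLg).eq, mul_assoc, ← mul_assoc (P.gL * P.gL),
      h₃, mul_assoc P.g, ← mul_assoc _ P.g, g_inv_mul, one_mul, ← mul_assoc, g_inv_mul, one_mul]
  rw [h₁, h₂] at h
  rw [h, ← P.hHat_S]
  congr 1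
  rw [mul_assoc, mul_assoc _ (P.W.S.symm q * _), mul_assoc (P.W.S.symm q), h₄]
  simp only [P.W.S_antimul, LinearEquiv.apply_symm_apply, S_gR_inv, mul_assoc]

/-- The left invariance of `ĥ`: `S(a₍₁₎) ⟨ĥ, a₍₂₎ b⟩ = b₍₁₎ ⟨ĥ, a b₍₂₎⟩`. -/
lemma hHat_invariant (a b : A) :
    rapp P.hHat (TensorProduct.map P.W.S.toLinearMap LinearMap.id (P.W.Δ a)
      * (1 : A) ⊗ₜ[ℂ] b) = rapp P.hHat ((1 : A) ⊗ₜ[ℂ] a * P.W.Δ b) := by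
  set l := P.h * (Ring.inverse P.gL * Ring.inverse P.gL) with hl
  obtain ⟨ψ, -, hψ, -⟩ := P.haar_nondeg b
  obtain ⟨φ, hφ⟩ : ∃ φ : A →ₗ[ℂ] ℂ, lapp φ (P.W.Δ l) = b := by
    refine ⟨ψ ∘ₗ LinearMap.mulRight ℂ (P.gL * P.gL), ?_⟩
    have h₁ : ∀ u : A ⊗[ℂ] A, lapp (ψ ∘ₗ LinearMap.mulRight ℂ (P.gL * P.gL)) u
        = lapp ψ (u * (P.gL * P.gL) ⊗ₜ[ℂ] (1 : A)) := by
      intro u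
      induction u with
      | zero => simp
      | add v w hv hw => simp only [map_add, add_mul, hv, hw]
      | tmul p q => simp [mul_assoc]
    rw [h₁, ← (P.memL_gL.mul P.memL_gL).Δ_mul_right, ← hψ, hl, mul_assoc, mul_assoc,
      ← mul_assoc _ P.gL P.gL, gL_inv_mul, one_mul, gL_inv_mul, mul_one]
  rw [← hφ]
  have h₂ : ∀ x y : A, ∀ u : A ⊗[ℂ] A, rapp P.hHat ((x ⊗ₜ[ℂ] y) * (1 : A) ⊗ₜ[ℂ] lapp φ u)
      = φ (rapp P.hHat ((1 : A) ⊗ₜ[ℂ] y * u)) • x := by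
    intro x y u
    induction u with
    | zero => simp
    | add v w hv hw =>
      simp only [map_add, mul_add, TensorProduct.tmul_add, add_smul, hv, hw]
    | tmul p q => simp [smul_smul, mul_comm]
  have h₃ : ∀ v : A ⊗[ℂ] A,
      rapp P.hHat (TensorProduct.map P.W.S.toLinearMap LinearMap.id v
        * (1 : A) ⊗ₜ[ℂ] lapp φ (P.W.Δ l))
      = lapp φ (TensorProduct.comm ℂ A A
          (TensorProduct.map P.W.S.toLinearMap P.W.S.toLinearMap v)) := by
    intro v
    induction v with
    | zero => simp
    | add v w hv hw => simp only [map_add, add_mul, hv, hw]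
    | tmul x y =>
      rw [TensorProduct.map_tmul, LinearMap.id_apply, h₂, ← S_eq_rapp_hHat]
      simp
  have h₅ := P.W.coassoc_apply ((rapp P.hHat ∘ₗ LinearMap.mulLeft ℂ ((1 : A) ⊗ₜ[ℂ] a)) ∘ₗ
    WeakHopfData.slice₁ φ) l
  simp only [LinearMap.comp_apply, WeakHopfData.slice₁_map_id_Δ, LinearMap.mulLeft_apply] at h₅
  rw [h₃, ← P.W.S_anticomul, ← h₅, P.S_eq_rapp_hHat a]
  induction P.W.Δ l with
  | zero => simp
  | add v w hv hw => simp only [map_add, mul_add, hv, hw]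
  | tmul p q => simp [WeakHopfData.slice₁]

/-- `a₍₁₎ ⟨ĥ, a₍₂₎ S(b)⟩ = ⟨ĥ, a S(b₍₁₎)⟩ b₍₂₎`. -/
lemma hHat_invariant_S (a b : A) :
    rapp P.hHat (P.W.Δ a * (1 : A) ⊗ₜ[ℂ] P.W.S b)
      = lapp P.hHat (a ⊗ₜ[ℂ] (1 : A)
        * TensorProduct.map P.W.S.toLinearMap LinearMap.id (P.W.Δ b)) := by
  have h := P.hHat_invariant a (P.W.S b)
  apply P.W.S.injective
  rw [P.W.S_anticomul] at h
  have h₁ : ∀ u : A ⊗[ℂ] A, P.W.S (rapp P.hHat (u * (1 : A) ⊗ₜ[ℂ] P.W.S b))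
      = rapp P.hHat (TensorProduct.map P.W.S.toLinearMap LinearMap.id u
        * (1 : A) ⊗ₜ[ℂ] P.W.S b) := by
    intro u
    induction u with
    | zero => simp
    | add v w hv hw => simp only [map_add, add_mul, hv, hw]
    | tmul p q => simp
  have h₂ : ∀ u : A ⊗[ℂ] A, P.W.S (lapp P.hHat (a ⊗ₜ[ℂ] (1 : A)
        * TensorProduct.map P.W.S.toLinearMap LinearMap.id u))
      = rapp P.hHat ((1 : A) ⊗ₜ[ℂ] a * TensorProduct.comm ℂ A A
          (TensorProduct.map P.W.S.toLinearMap P.W.S.toLinearMap u)) := by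
    intro u
    induction u with
    | zero => simp
    | add v w hv hw => simp only [map_add, mul_add, hv, hw]
    | tmul p q => simp
  rw [h₁, h, h₂]

/-- The functional `x ↦ ⟨ĥ, gR⁻² ε^L(x)⟩`. -/
def tau : A →ₗ[ℂ] ℂ :=
  P.hHat ∘ₗ LinearMap.mulLeft ℂ (Ring.inverse P.gR * Ring.inverse P.gR) ∘ₗ P.W.εL

/-- `x₍₁₎ τ(x₍₂₎) = τ(x₍₁₎) x₍₂₎`. -/
lemma rapp_tau_Δ (x : A) : rapp P.tau (P.W.Δ x) = lapp P.tau (P.W.Δ x) := by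
  set c := Ring.inverse P.gR * Ring.inverse P.gR with hc
  have hcR : P.W.MemR c := P.memR_gR_inv.mul P.memR_gR_inv
  let m : A ⊗[ℂ] A →ₗ[ℂ] ℂ := P.hHat ∘ₗ LinearMap.mulLeft ℂ c ∘ₗ LinearMap.mul' ℂ A ∘ₗ
    TensorProduct.map LinearMap.id P.W.S.toLinearMap
  have hm : m ∘ₗ P.W.Δ = P.tau := rfl
  have h₁ := P.W.coassoc_apply ((TensorProduct.lid ℂ A).toLinearMap ∘ₗ
    TensorProduct.map m LinearMap.id) x
  have h₂ := P.W.coassoc_apply ((TensorProduct.rid ℂ A).toLinearMap ∘ₗ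
    TensorProduct.map LinearMap.id m ∘ₗ (TensorProduct.assoc ℂ A A A).toLinearMap) x
  simp only [LinearMap.comp_apply, LinearEquiv.coe_coe, LinearEquiv.apply_symm_apply,
    TensorProduct.map_map, hm, LinearMap.comp_id] at h₁ h₂
  have h₃ : rapp P.tau (P.W.Δ x)
      = TensorProduct.rid ℂ A (TensorProduct.map LinearMap.id P.tau (P.W.Δ x)) := rfl
  have h₄ : lapp P.tau (P.W.Δ x)
      = TensorProduct.lid ℂ A (TensorProduct.map P.tau LinearMap.id (P.W.Δ x)) := rfl
  rw [h₃, h₄, h₁, ← h₂]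
  have h₅ : ∀ (p : A ⊗[ℂ] A) (b : A), TensorProduct.rid ℂ A (TensorProduct.map LinearMap.id m
      (TensorProduct.assoc ℂ A A A (p ⊗ₜ[ℂ] b)))
      = rapp P.hHat ((1 : A) ⊗ₜ[ℂ] c * p * (1 : A) ⊗ₜ[ℂ] P.W.S b) := by
    intro p b
    induction p with
    | zero => simp
    | add v w hv hw => simp only [map_add, TensorProduct.add_tmul, mul_add, add_mul, hv, hw]
    | tmul p q => simp [m, mul_assoc]
  have h₆ : ∀ (a : A) (v : A ⊗[ℂ] A), TensorProduct.lid ℂ A (TensorProduct.map m LinearMap.id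
      ((TensorProduct.assoc ℂ A A A).symm (a ⊗ₜ[ℂ] v)))
      = lapp P.hHat ((c * a) ⊗ₜ[ℂ] (1 : A)
        * TensorProduct.map P.W.S.toLinearMap LinearMap.id v) := by
    intro a v
    induction v with
    | zero => simp
    | add v w hv hw => simp only [map_add, TensorProduct.tmul_add, mul_add, hv, hw]
    | tmul p q => simp [m, mul_assoc]
  induction P.W.Δ x with
  | zero => simp
  | add v w hv hw => simp only [map_add, hv, hw]
  | tmul a b =>
    rw [TensorProduct.map_tmul, TensorProduct.map_tmul, LinearMap.id_apply, LinearMap.id_apply,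
      h₅, h₆, ← hcR.Δ_mul_left, hHat_invariant_S]

lemma lapp_hHat_mul (u : A ⊗[ℂ] A) (a : A) (ψ : A →ₗ[ℂ] ℂ) :
    ψ (lapp P.hHat (u * a ⊗ₜ[ℂ] (1 : A))) = P.hHat (rapp ψ u * a) := by
  induction u with
  | zero => simp
  | add v w hv hw => simp only [map_add, add_mul, hv, hw]
  | tmul p q => simp [mul_comm]

lemma rapp_hHat_mul (u : A ⊗[ℂ] A) (a : A) (ψ : A →ₗ[ℂ] ℂ) :
    ψ (rapp (P.hHat ∘ₗ LinearMap.mulLeft ℂ a) u) = P.hHat (a * lapp ψ u) := by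
  induction u with
  | zero => simp
  | add v w hv hw => simp only [map_add, mul_add, hv, hw]
  | tmul p q => simp [mul_comm]

lemma jayEl_eq : P.jayEl = lapp P.hHat (P.W.Δ 1
    * (Ring.inverse P.gL * Ring.inverse P.gL) ⊗ₜ[ℂ] (1 : A)) := by
  rw [← (P.memL_gL_inv.mul P.memL_gL_inv).2]; rfl

lemma tau_eq_ε_mul_jayEl (x : A) : P.tau x = P.W.ε (x * P.jayEl) := by
  have h₁ : ∀ u : A ⊗[ℂ] A, P.hHat (Ring.inverse P.gR * Ring.inverse P.gR * LinearMap.mul' ℂ A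
      (TensorProduct.map LinearMap.id P.W.S.toLinearMap u)) = P.hHat (LinearMap.mul' ℂ A
      (TensorProduct.map P.W.S.toLinearMap LinearMap.id u)
        * (Ring.inverse P.gL * Ring.inverse P.gL)) := by
    intro u
    induction u with
    | zero => simp
    | add v w hv hw => simp only [map_add, add_mul, mul_add, hv, hw]
    | tmul p q => simpa using P.hHat_swap p q
  calc P.tau x = P.hHat (P.W.εR x * (Ring.inverse P.gL * Ring.inverse P.gL)) := h₁ _
    _ = _ := by
      rw [P.W.εR_eq, ← lapp_hHat_mul, ← jayEl_eq, LinearMap.comp_apply, LinearMap.mulLeft_apply]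

lemma lapp_tau_Δ_one : lapp P.tau (P.W.Δ 1) = P.jayEl := by
  have h₁ : ∀ u : A ⊗[ℂ] A, lapp P.tau u
      = lapp (P.hHat ∘ₗ LinearMap.mulLeft ℂ (Ring.inverse P.gR * Ring.inverse P.gR))
        (TensorProduct.map P.W.εL LinearMap.id u) := by
    intro u
    induction u with
    | zero => simp
    | add v w hv hw => simp only [map_add, hv, hw]
    | tmul p q => simp [tau]
  have h₂ : ∀ u : A ⊗[ℂ] A,
      lapp (P.hHat ∘ₗ LinearMap.mulLeft ℂ (Ring.inverse P.gR * Ring.inverse P.gR))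
        (TensorProduct.map P.W.S.toLinearMap LinearMap.id u)
      = lapp P.hHat (u * (Ring.inverse P.gL * Ring.inverse P.gL) ⊗ₜ[ℂ] (1 : A)) := by
    intro u
    induction u with
    | zero => simp
    | add v w hv hw => simp only [map_add, add_mul, hv, hw]
    | tmul p q =>
      have := P.hHat_S (p * (Ring.inverse P.gL * Ring.inverse P.gL))
      simp only [P.W.S_antimul, S_gL_inv] at this
      simp [← this, -LinearMap.mulLeft_mul]
  rw [h₁, P.W.map_εL_id_Δ_one, h₂, jayEl_eq]

/-- `ȷ` is central. -/
lemma commute_jayEl (x : A) : Commute x P.jayEl := by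
  set z := rapp (P.hHat ∘ₗ LinearMap.mulLeft ℂ (Ring.inverse P.gR * Ring.inverse P.gR)) (P.W.Δ 1)
    with hz
  have hzR : P.W.MemR z := P.W.memR_rapp _
  have hτ : P.tau = P.W.ε ∘ₗ LinearMap.mulLeft ℂ z := by
    ext y
    have := P.rapp_hHat_mul (P.W.Δ 1) (Ring.inverse P.gR * Ring.inverse P.gR)
      (P.W.ε ∘ₗ LinearMap.mulRight ℂ y)
    rw [← P.W.εL_eq] at this
    simpa [tau, -LinearMap.mulLeft_mul] using this.symm
  have hl : ∀ (y : A) (u : A ⊗[ℂ] A), rapp (P.W.ε ∘ₗ LinearMap.mulLeft ℂ y) u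
      = rapp P.W.ε ((1 : A) ⊗ₜ[ℂ] y * u) := by
    intro y u
    induction u with
    | zero => simp
    | add v w hv hw => simp only [map_add, mul_add, hv, hw]
    | tmul p q => simp
  have hr : ∀ (y : A) (u : A ⊗[ℂ] A), rapp (P.W.ε ∘ₗ LinearMap.mulRight ℂ y) u
      = rapp P.W.ε (u * (1 : A) ⊗ₜ[ℂ] y) := by
    intro y u
    induction u with
    | zero => simp
    | add v w hv hw => simp only [map_add, add_mul, hv, hw]
    | tmul p q => simp
  have h₁ : ∀ y, rapp P.tau (P.W.Δ y) = z * y := by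
    intro y
    rw [hτ, hl, ← hzR.Δ_mul_left, P.W.rapp_ε_Δ]
  have hzj : z = P.jayEl := by
    rw [← lapp_tau_Δ_one, ← rapp_tau_Δ, h₁, mul_one]
  have h₂ : P.tau = P.W.ε ∘ₗ LinearMap.mulRight ℂ z := by
    ext y; rw [tau_eq_ε_mul_jayEl, hzj]; rfl
  rw [← hzj, commute_iff_eq, ← h₁ x, h₂, hr, ← hzR.Δ_mul_right, P.W.rapp_ε_Δ]

lemma starT_zero : P.W.starT 0 = 0 := by
  have h := P.W.starT_add 0 0
  rwa [add_zero, left_eq_add] at h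

lemma starT_sum {ι : Type*} (s : Finset ι) (f : ι → A ⊗[ℂ] A) :
    P.W.starT (∑ i ∈ s, f i) = ∑ i ∈ s, P.W.starT (f i) := by
  classical
  induction s using Finset.induction_on with
  | empty => simp [starT_zero]
  | insert i s hi ih => rw [Finset.sum_insert hi, Finset.sum_insert hi, P.W.starT_add, ih]

lemma isPosElem_rapp_hHat_Δ (x : A) : IsPosElem (rapp P.hHat (P.W.Δ (star x * x))) := by
  obtain ⟨s, hs⟩ := TensorProduct.exists_finset (P.W.Δ x)
  have h := isPosElem_gram P.hHat_pos (fun i : s => i.1.1) (fun i : s => i.1.2)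
  rw [← Finset.sum_coe_sort] at hs
  rw [P.W.Δ_mul, P.W.Δ_star, hs, starT_sum, Finset.sum_mul_sum]
  simpa [P.W.starT_tmul, map_sum] using h

lemma isPosElem_lapp_hHat_Δ (x : A) : IsPosElem (lapp P.hHat (P.W.Δ (star x * x))) := by
  obtain ⟨s, hs⟩ := TensorProduct.exists_finset (P.W.Δ x)
  have h := isPosElem_gram P.hHat_pos (fun i : s => i.1.2) (fun i : s => i.1.1)
  rw [← Finset.sum_coe_sort] at hs
  rw [P.W.Δ_mul, P.W.Δ_star, hs, starT_sum, Finset.sum_mul_sum]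
  simpa [P.W.starT_tmul, map_sum] using h

lemma isPosElem_jayEl : IsPosElem P.jayEl := by
  have h := P.isPosElem_lapp_hHat_Δ (Ring.inverse P.gL)
  rwa [P.gL_pos.star_inverse] at h

lemma memL_iotaEl : P.W.MemL P.iotaEl := P.W.memL_εL _

lemma isPosElem_iotaEl : IsPosElem P.iotaEl := by
  have h₁ : P.iotaEl * P.h = star (Ring.inverse P.gL * P.h) * (Ring.inverse P.gL * P.h) := by
    rw [iotaEl, ← P.haar_left, star_mul, P.gL_pos.star_inverse, P.haar_star]
    simp only [mul_assoc]
  have h := P.isPosElem_rapp_hHat_Δ (Ring.inverse P.gL * P.h)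
  rw [← h₁, P.memL_iotaEl.Δ_mul_left, rapp_inl_mul, ← P.gL_sq] at h
  have h' := h.mul_mul P.gL_pos.star_inverse
  have e : Ring.inverse P.gL * (P.iotaEl * (P.gL * P.gL)) * Ring.inverse P.gL = P.iotaEl := by
    rw [← mul_assoc, (P.commute_iotaEl _).eq, mul_assoc, mul_assoc, mul_assoc, ← mul_assoc _ P.gL,
      gL_inv_mul, one_mul, gL_mul_inv, mul_one]
  rwa [e] at h'

lemma isPosElem_sqrt_g : IsPosElem (P.sqrt P.g) := P.sqrt_pos _ P.g_pos

lemma sqrt_g_mul_self : P.sqrt P.g * P.sqrt P.g = P.g := P.sqrt_mul_self _ P.g_pos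

lemma isUnit_sqrt_g : IsUnit (P.sqrt P.g) := by
  have h : IsUnit (P.sqrt P.g * P.sqrt P.g) := by
    rw [sqrt_g_mul_self]; exact P.g_unit
  exact ((Commute.refl _).isUnit_mul_iff.1 h).1

lemma commute_sqrt_g_gR : Commute (P.sqrt P.g) P.gR := by
  refine P.isPosElem_sqrt_g.commute_of_commute_mul_self ?_
  rw [sqrt_g_mul_self]
  exact P.commute_gL_gR.mul_left (commute_ringInverse (Commute.refl _) P.gR_unit).symm

/-- The central factor `ı^{1/2} ȷ^{1/2}` of `ξ^{1/2}`. -/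
def centralRoot : A := P.sqrt P.iotaEl * P.sqrt P.jayEl

lemma commute_sqrt_iotaEl (x : A) : Commute (P.sqrt P.iotaEl) x :=
  (P.sqrt_pos _ P.isPosElem_iotaEl).commute_of_commute_mul_self <| by
    rw [P.sqrt_mul_self _ P.isPosElem_iotaEl]
    exact (P.commute_iotaEl x).symm

lemma commute_sqrt_jayEl (x : A) : Commute (P.sqrt P.jayEl) x :=
  (P.sqrt_pos _ P.isPosElem_jayEl).commute_of_commute_mul_self <| by
    rw [P.sqrt_mul_self _ P.isPosElem_jayEl]
    exact (P.commute_jayEl x).symm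

lemma commute_centralRoot (x : A) : Commute P.centralRoot x :=
  (P.commute_sqrt_iotaEl x).mul_left (P.commute_sqrt_jayEl x)

lemma isPosElem_centralRoot : IsPosElem P.centralRoot :=
  (P.sqrt_pos _ P.isPosElem_iotaEl).mul_of_commute (P.sqrt_pos _ P.isPosElem_jayEl)
    (P.commute_sqrt_iotaEl _)

lemma sqrt_ξ : P.sqrt P.ξ = P.centralRoot * (P.gR * P.sqrt P.g) := by
  have hpos : IsPosElem (P.centralRoot * (P.gR * P.sqrt P.g)) :=
    P.isPosElem_centralRoot.mul_of_commute
      (P.gR_pos.mul_of_commute P.isPosElem_sqrt_g P.commute_sqrt_g_gR.symm)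
      (P.commute_centralRoot _)
  have e : P.gR * P.sqrt P.g * (P.gR * P.sqrt P.g) = P.gL * P.gR := by
    rw [mul_assoc, ← mul_assoc (P.sqrt P.g), P.commute_sqrt_g_gR.eq, mul_assoc P.gR,
      sqrt_g_mul_self, g_eq, (commute_ringInverse P.commute_gL_gR P.gR_unit).eq,
      ← mul_assoc P.gR (Ring.inverse _), gR_mul_inv, one_mul, P.commute_gL_gR.eq]
  have hsq : P.ξ = P.centralRoot * (P.gR * P.sqrt P.g)
      * (P.centralRoot * (P.gR * P.sqrt P.g)) := by
    rw [((P.commute_centralRoot (P.gR * P.sqrt P.g)).symm).mul_mul_mul_comm, e, ξ, ξL, ξR,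
      ← centralRoot, ((P.commute_centralRoot P.gL).symm).mul_mul_mul_comm]
  have hξ : IsPosElem P.ξ := ⟨P.centralRoot * (P.gR * P.sqrt P.g), by rw [hpos.star_eq, hsq]⟩
  exact (P.sqrt_pos _ hξ).eq_of_mul_self_eq hpos (by rw [P.sqrt_mul_self _ hξ, hsq])

/-- The tensor `S(h₍₁₎) ⊗ h₍₂₎`. -/
def separability : A ⊗[ℂ] A :=
  TensorProduct.map P.W.S.toLinearMap LinearMap.id (P.W.Δ P.h)

lemma map_S_mul_inl (u : A ⊗[ℂ] A) (a : A) :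
    TensorProduct.map P.W.S.toLinearMap LinearMap.id (u * a ⊗ₜ[ℂ] (1 : A))
      = P.W.S a ⊗ₜ[ℂ] (1 : A) * TensorProduct.map P.W.S.toLinearMap LinearMap.id u := by
  induction u with
  | zero => simp
  | add v w hv hw => simp only [map_add, add_mul, mul_add, hv, hw]
  | tmul p q => simp [P.W.S_antimul]

lemma map_S_inl_mul (u : A ⊗[ℂ] A) (a : A) :
    TensorProduct.map P.W.S.toLinearMap LinearMap.id (a ⊗ₜ[ℂ] (1 : A) * u)
      = TensorProduct.map P.W.S.toLinearMap LinearMap.id u * P.W.S a ⊗ₜ[ℂ] (1 : A) := by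
  induction u with
  | zero => simp
  | add v w hv hw => simp only [map_add, add_mul, mul_add, hv, hw]
  | tmul p q => simp [P.W.S_antimul]

lemma map_S_mul_inr (u : A ⊗[ℂ] A) (a : A) :
    TensorProduct.map P.W.S.toLinearMap LinearMap.id (u * (1 : A) ⊗ₜ[ℂ] a)
      = TensorProduct.map P.W.S.toLinearMap LinearMap.id u * (1 : A) ⊗ₜ[ℂ] a := by
  induction u with
  | zero => simp
  | add v w hv hw => simp only [map_add, add_mul, hv, hw]
  | tmul p q => simp

lemma map_S_inr_mul (u : A ⊗[ℂ] A) (a : A) :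
    TensorProduct.map P.W.S.toLinearMap LinearMap.id ((1 : A) ⊗ₜ[ℂ] a * u)
      = (1 : A) ⊗ₜ[ℂ] a * TensorProduct.map P.W.S.toLinearMap LinearMap.id u := by
  induction u with
  | zero => simp
  | add v w hv hw => simp only [map_add, mul_add, hv, hw]
  | tmul p q => simp

lemma inl_mul_separability (x : A) :
    x ⊗ₜ[ℂ] (1 : A) * P.separability = P.separability * (1 : A) ⊗ₜ[ℂ] x := by
  obtain ⟨z, rfl⟩ := P.W.S.surjective x
  rw [separability, ← map_S_mul_inl, Δ_h_mul_inl, map_S_mul_inr]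

lemma separability_mul_inl (y : A) :
    P.separability * P.W.S (P.W.S y) ⊗ₜ[ℂ] (1 : A) = (1 : A) ⊗ₜ[ℂ] y * P.separability := by
  rw [separability, ← map_S_inl_mul, inl_S_mul_Δ_h, map_S_inr_mul]

lemma map_Jlin_Δ_Ω (hι : IsUnit P.iotaEl) :
    TensorProduct.map P.Jlin LinearMap.id (P.W.Δ P.Ω)
      = (Ring.inverse (P.sqrt P.g) * Ring.inverse P.gR) ⊗ₜ[ℂ] (1 : A) * P.separability
        * (Ring.inverse P.gR * P.W.S (Ring.inverse P.iotaEl) * P.sqrt P.g) ⊗ₜ[ℂ] (1 : A) := by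
  have hL : P.W.MemL (Ring.inverse P.iotaEl) :=
    P.memL_iotaEl.inverse (Ring.mul_inverse_cancel _ hι) (Ring.inverse_mul_cancel _ hι)
  rw [Ω, P.memL_gL_inv.Δ_mul_right, (hL.mul P.memL_gL_inv).Δ_mul_left, separability]
  induction P.W.Δ P.h with
  | zero => simp
  | add v w hv hw => simp only [map_add, mul_add, add_mul, hv, hw]
  | tmul p q => simp [Jlin, P.W.S_antimul, S_gL_inv, mul_assoc]

lemma commute_S_inverse_iotaEl (hι : IsUnit P.iotaEl) (x : A) :
    Commute (P.W.S (Ring.inverse P.iotaEl)) x := by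
  obtain ⟨z, rfl⟩ := P.W.S.surjective x
  rw [commute_iff_eq, ← P.W.S_antimul, ← P.W.S_antimul,
    (commute_ringInverse (P.commute_iotaEl z) hι).eq]

lemma inl_mul_map_Jlin_Δ_Ω (x : A) :
    (x * P.sqrt P.ξ) ⊗ₜ[ℂ] (1 : A) * TensorProduct.map P.Jlin LinearMap.id (P.W.Δ P.Ω)
      = P.sqrt P.ξ ⊗ₜ[ℂ] (1 : A) * TensorProduct.map P.Jlin LinearMap.id (P.W.Δ P.Ω)
        * (1 : A) ⊗ₜ[ℂ] x := by
  by_cases hι : IsUnit P.iotaEl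
  · have e : P.sqrt P.ξ * (Ring.inverse (P.sqrt P.g) * Ring.inverse P.gR) = P.centralRoot := by
      rw [sqrt_ξ, mul_assoc, mul_assoc, ← mul_assoc (P.sqrt P.g),
        Ring.mul_inverse_cancel _ P.isUnit_sqrt_g, one_mul, gR_mul_inv, mul_one]
    simp only [P.map_Jlin_Δ_Ω hι, ← mul_assoc, inl_mul_inl]
    rw [mul_assoc x, mul_assoc (P.sqrt P.ξ), mul_assoc x, mul_assoc (P.sqrt P.ξ), e,
      ← (P.commute_centralRoot x).eq, ← inl_mul_inl, mul_assoc _ _ P.separability,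
      inl_mul_separability]
    simp only [mul_assoc, inl_mul_inr_comm]
  · simp [Ω, Ring.inverse_non_unit _ hι]

lemma map_Jlin_Δ_Ω_mul_inl (y : A) :
    TensorProduct.map P.Jlin LinearMap.id (P.W.Δ P.Ω) * (P.sqrt P.ξ * y) ⊗ₜ[ℂ] (1 : A)
      = (1 : A) ⊗ₜ[ℂ] y * (TensorProduct.map P.Jlin LinearMap.id (P.W.Δ P.Ω)
        * P.sqrt P.ξ ⊗ₜ[ℂ] (1 : A)) := by
  by_cases hι : IsUnit P.iotaEl
  · set d := P.W.S (Ring.inverse P.iotaEl) with hd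
    have hdc : ∀ x, Commute d x := P.commute_S_inverse_iotaEl hι
    have e : Ring.inverse P.gR * d * P.sqrt P.g * P.sqrt P.ξ = d * P.centralRoot * P.g := by
      rw [sqrt_ξ, ← (hdc _).eq, mul_assoc, mul_assoc, mul_assoc d, ← mul_assoc (P.sqrt P.g),
        ← (P.commute_centralRoot _).eq, mul_assoc P.centralRoot, ← mul_assoc _ P.centralRoot,
        ← (P.commute_centralRoot _).eq, ← mul_assoc (P.sqrt P.g), P.commute_sqrt_g_gR.eq,
        mul_assoc P.gR, mul_assoc P.centralRoot, ← mul_assoc _ P.gR, gR_inv_mul, one_mul,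
        sqrt_g_mul_self]
    have hg : P.g * y = P.W.S (P.W.S y) * P.g := by
      rw [P.S_sq, ← g_eq, mul_assoc, g_inv_mul, mul_one]
    have e' : d * P.centralRoot * P.g * y
        = P.W.S (P.W.S y) * (d * P.centralRoot * P.g) := by
      rw [mul_assoc, hg, ← mul_assoc, ← mul_assoc,
        ((hdc _).mul_left (P.commute_centralRoot (P.W.S (P.W.S y)))).eq, mul_assoc]
    rw [P.map_Jlin_Δ_Ω hι, ← hd, mul_assoc _ _ ((P.sqrt P.ξ * y) ⊗ₜ[ℂ] (1 : A)),
      mul_assoc _ _ (P.sqrt P.ξ ⊗ₜ[ℂ] (1 : A)), inl_mul_inl, inl_mul_inl, ← mul_assoc _ _ y, e,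
      e', ← inl_mul_inl (P.W.S (P.W.S y)), mul_assoc _ P.separability, ← mul_assoc P.separability,
      separability_mul_inl]
    simp only [← mul_assoc, ← inl_mul_inr_comm]
  · simp [Ω, Ring.inverse_non_unit _ hι]

end HaarPkg

/-- **The pulling-through identities, symmetric form.**
For all `x, y ∈ A` in `A ⊗ A`:
`x ξ^{1/2} J(Ω₍₁₎) ⊗ Ω₍₂₎ = ξ^{1/2} J(Ω₍₁₎) ⊗ Ω₍₂₎ x` and
`J(Ω₍₁₎) ξ^{1/2} y ⊗ Ω₍₂₎ = J(Ω₍₁₎) ξ^{1/2} ⊗ y Ω₍₂₎`. -/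
theorem HaarPkg.pulling_through_xi {A : Type*} [NormedRing A] [StarRing A] [CStarRing A]
    [NormedAlgebra ℂ A] [StarModule ℂ A] [FiniteDimensional ℂ A]
    (P : HaarPkg A) (x y : A) :
    TensorProduct.map (LinearMap.mulLeft ℂ (x * P.sqrt P.ξ) ∘ₗ P.Jlin) LinearMap.id
        (P.W.Δ P.Ω)
      = TensorProduct.map (LinearMap.mulLeft ℂ (P.sqrt P.ξ) ∘ₗ P.Jlin)
          (LinearMap.mulRight ℂ x) (P.W.Δ P.Ω) ∧
    TensorProduct.map (LinearMap.mulRight ℂ (P.sqrt P.ξ * y) ∘ₗ P.Jlin) LinearMap.id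
        (P.W.Δ P.Ω)
      = TensorProduct.map (LinearMap.mulRight ℂ (P.sqrt P.ξ) ∘ₗ P.Jlin)
          (LinearMap.mulLeft ℂ y) (P.W.Δ P.Ω) := by

  have h₁ : ∀ (a b : A) (u : A ⊗[ℂ] A),
      TensorProduct.map (LinearMap.mulLeft ℂ a ∘ₗ P.Jlin) (LinearMap.mulRight ℂ b) u
      = a ⊗ₜ[ℂ] (1 : A) * TensorProduct.map P.Jlin LinearMap.id u * (1 : A) ⊗ₜ[ℂ] b := by
    intro a b u
    induction u with
    | zero => simp
    | add v w hv hw => simp only [map_add, mul_add, add_mul, hv, hw]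
    | tmul p q => simp
  have h₂ : ∀ (a b : A) (u : A ⊗[ℂ] A),
      TensorProduct.map (LinearMap.mulRight ℂ a ∘ₗ P.Jlin) (LinearMap.mulLeft ℂ b) u
      = (1 : A) ⊗ₜ[ℂ] b * (TensorProduct.map P.Jlin LinearMap.id u * a ⊗ₜ[ℂ] (1 : A)) := by
    intro a b u
    induction u with
    | zero => simp
    | add v w hv hw => simp only [map_add, mul_add, add_mul, hv, hw]
    | tmul p q => simp
  constructor
  · rw [← LinearMap.mulRight_one (R := ℂ) (A := A), h₁, h₁,
      P.inl_mul_map_Jlin_Δ_Ω, mul_assoc _ _ ((1 : A) ⊗ₜ[ℂ] (1 : A)),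
      ← Algebra.TensorProduct.one_def, mul_one]
  · rw [← LinearMap.mulLeft_one (R := ℂ) (A := A), h₂, h₂,
      P.map_Jlin_Δ_Ω_mul_inl, ← Algebra.TensorProduct.one_def, one_mul]

end
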